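/- Let Ω be the x-periodic channel under the graph of h ∈ C^{1,1}(T) with 0 < h₀ ≤ h ≤ h₁ on [0,L]. Then every mean-zero p ∈ L²(Ω) satisfies ‖p‖_{L²(Ω)} ≤ β⁻¹·‖∇p‖_{H⁻¹(Ω)}, where β⁻¹ = (9/4)(1+M²)(h₁/h₀)^{1/2}·max(4, L/h₀, h₁/h₀) and M² = max(‖h_x‖²_∞, ‖(1/2)h·h_{xx}‖_∞). -/

import Mathlib

open MeasureTheory Set

/-- The x-periodic channel `Ω = {(x,y) : x ∈ T, 0 < y < h(x)}`. -/
def ChannelOmega (L : ℝ) (h : ℝ → ℝ) : Set (ℝ × ℝ) :=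
  {p : ℝ × ℝ | p.1 ∈ Set.Ioo 0 L ∧ p.2 ∈ Set.Ioo 0 (h p.1)}

/-- Test functions modeling `H¹₀(Ω)`: `C¹`, `L`-periodic in `x`, vanishing on
the bottom wall `y = 0` and the top wall `y = h(x)`. -/
def AdmChannel (L : ℝ) (h : ℝ → ℝ) (u : ℝ × ℝ → ℝ) : Prop :=
  ContDiff ℝ 1 u ∧ (∀ x y, u (x + L, y) = u (x, y)) ∧
    (∀ x, u (x, 0) = 0) ∧ (∀ x, u (x, h x) = 0)

/-- The squared energy (H¹ semi-)norm `‖∇u‖²_{L²(Ω)}`. -/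
noncomputable def energyChannel (L : ℝ) (h : ℝ → ℝ) (u : ℝ × ℝ → ℝ) : ℝ :=
  ∫ p in ChannelOmega L h, (fderiv ℝ u p (1, 0)) ^ 2 + (fderiv ℝ u p (0, 1)) ^ 2

/-- The Neumann problem `φ'' - κ² φ = f`, `φ'(0) = φ'(1) = 0`. -/
theorem exists_neumann_solution {κ : ℝ} (hκ : 0 < κ) {f : ℝ → ℝ} (hf : Continuous f) :
    ∃ φ φ' : ℝ → ℝ, (∀ z, HasDerivAt φ (φ' z) z) ∧
      (∀ z, HasDerivAt φ' (κ ^ 2 * φ z + f z) z) ∧ φ' 0 = 0 ∧ φ' 1 = 0 := by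
  have he : ∀ (c z : ℝ), HasDerivAt (fun z => Real.exp (c * z)) (Real.exp (c * z) * c) z := by
    intro c z
    simpa using ((hasDerivAt_id z).const_mul c).exp
  have hF : ∀ (c z : ℝ), HasDerivAt (fun z => ∫ s in (0 : ℝ)..z, Real.exp (c * s) * f s)
      (Real.exp (c * z) * f z) z := by
    intro c z
    have hc : Continuous fun s => Real.exp (c * s) * f s := by fun_prop
    exact intervalIntegral.integral_hasDerivAt_right (hc.intervalIntegrable _ _)
      (hc.stronglyMeasurableAtFilter _ _) hc.continuousAt
  set P := fun z => ∫ s in (0 : ℝ)..z, Real.exp (-κ * s) * f s with hP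
  set Q := fun z => ∫ s in (0 : ℝ)..z, Real.exp (κ * s) * f s with hQ
  have hne : Real.exp (κ * 1) - Real.exp (-κ * 1) ≠ 0 := by
    have : Real.exp (-κ * 1) < Real.exp (κ * 1) := Real.exp_lt_exp.2 (by linarith)
    linarith
  set c := -((Real.exp (κ * 1) * P 1 + Real.exp (-κ * 1) * Q 1) / 2) /
    (κ * (Real.exp (κ * 1) - Real.exp (-κ * 1))) with hc
  have hmul : ∀ z, Real.exp (κ * z) * Real.exp (-κ * z) = 1 := by
    intro z; rw [← Real.exp_add]; simp
  refine ⟨fun z => (Real.exp (κ * z) * P z - Real.exp (-κ * z) * Q z) / (2 * κ) +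
      c * (Real.exp (κ * z) + Real.exp (-κ * z)),
    fun z => (Real.exp (κ * z) * P z + Real.exp (-κ * z) * Q z) / 2 +
      c * κ * (Real.exp (κ * z) - Real.exp (-κ * z)), ?_, ?_, ?_, ?_⟩
  · intro z
    have h := (((he κ z).mul (hF (-κ) z)).sub ((he (-κ) z).mul (hF κ z))).div_const (2 * κ)
      |>.add (((he κ z).add (he (-κ) z)).const_mul c)
    refine h.congr_deriv ?_
    simp only [hP, hQ]
    field_simp
    ring
  · intro z
    have h := (((he κ z).mul (hF (-κ) z)).add ((he (-κ) z).mul (hF κ z))).div_const 2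
      |>.add (((he κ z).sub (he (-κ) z)).const_mul (c * κ))
    refine h.congr_deriv ?_
    have h1 := hmul z
    simp only [hP, hQ]
    generalize Real.exp (κ * z) = a at *
    generalize Real.exp (-κ * z) = b at *
    field_simp
    linear_combination (2 * f z) * h1
  · simp [hP, hQ]
  · simp only [hc]
    generalize Real.exp (κ * 1) = a at *
    generalize Real.exp (-κ * 1) = b at *
    field_simp
    ring

/-- Energy identities for the Neumann problem. -/
theorem neumann_energy {κ : ℝ} (hκ : 0 < κ) {f φ φ' : ℝ → ℝ} (hf : Continuous f)
    (h1 : ∀ z, HasDerivAt φ (φ' z) z) (h2 : ∀ z, HasDerivAt φ' (κ ^ 2 * φ z + f z) z)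
    (h0 : φ' 0 = 0) (h3 : φ' 1 = 0) :
    (∫ z in (0 : ℝ)..1, (κ ^ 2 * φ z + f z) ^ 2) ≤ ∫ z in (0 : ℝ)..1, f z ^ 2 ∧
    κ ^ 4 * (∫ z in (0 : ℝ)..1, φ z ^ 2) ≤ ∫ z in (0 : ℝ)..1, f z ^ 2 ∧
    κ ^ 2 * (∫ z in (0 : ℝ)..1, φ' z ^ 2) ≤ (∫ z in (0 : ℝ)..1, f z ^ 2) / 4 ∧
    κ ^ 2 * (φ 0 ^ 2 + φ 1 ^ 2) ≤ (2 / κ ^ 2 + 3 / (4 * κ)) * ∫ z in (0 : ℝ)..1, f z ^ 2 := by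
  have cφ : Continuous φ := continuous_iff_continuousAt.2 fun z => (h1 z).continuousAt
  have cφ' : Continuous φ' := continuous_iff_continuousAt.2 fun z => (h2 z).continuousAt
  have ii : ∀ {g : ℝ → ℝ}, Continuous g → IntervalIntegrable g volume 0 1 :=
    fun hg => hg.intervalIntegrable _ _
  -- integration by parts
  have hparts : ∫ z in (0 : ℝ)..1, (φ' z ^ 2 + φ z * (κ ^ 2 * φ z + f z)) = 0 := by
    rw [intervalIntegral.integral_eq_sub_of_hasDerivAt (f := fun z => φ z * φ' z)]
    · simp [h0, h3]
    · intro z _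
      refine ((h1 z).mul (h2 z)).congr_deriv ?_
      ring
    · exact ii (by fun_prop)
  have htrace : ∫ z in (0 : ℝ)..1, (2 * φ z ^ 2 + (2 * z - 1) * (2 * φ z * φ' z)) =
      φ 0 ^ 2 + φ 1 ^ 2 := by
    rw [intervalIntegral.integral_eq_sub_of_hasDerivAt (f := fun z => (2 * z - 1) * φ z ^ 2)]
    · ring
    · intro z _
      have := (((hasDerivAt_id z).const_mul 2).sub_const 1).mul ((h1 z).pow 2)
      refine this.congr_deriv ?_
      simp
    · exact ii (by fun_prop)
  set A := ∫ z in (0 : ℝ)..1, (κ ^ 2 * φ z + f z) ^ 2 with hA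
  set B := ∫ z in (0 : ℝ)..1, φ' z ^ 2 with hB
  set C := ∫ z in (0 : ℝ)..1, φ z ^ 2 with hC
  set I := ∫ z in (0 : ℝ)..1, f z ^ 2 with hI
  have hBn : 0 ≤ B := intervalIntegral.integral_nonneg zero_le_one fun z _ => sq_nonneg _
  have hAn : 0 ≤ A := intervalIntegral.integral_nonneg zero_le_one fun z _ => sq_nonneg _
  have hCn : 0 ≤ C := intervalIntegral.integral_nonneg zero_le_one fun z _ => sq_nonneg _
  set D := ∫ z in (0 : ℝ)..1, φ z * (κ ^ 2 * φ z + f z) with hD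
  have e0 : B + D = 0 := by
    rw [← hparts, intervalIntegral.integral_add (ii (by fun_prop)) (ii (by fun_prop))]
  have e1 : I = A - 2 * κ ^ 2 * D + κ ^ 4 * C := by
    rw [hA, hD, hC, ← intervalIntegral.integral_const_mul, ← intervalIntegral.integral_const_mul,
      ← intervalIntegral.integral_sub (ii (by fun_prop)) (ii (by fun_prop)),
      ← intervalIntegral.integral_add (ii (by fun_prop)) (ii (by fun_prop))]
    refine intervalIntegral.integral_congr fun z _ => ?_
    ring
  have e2 : 0 ≤ A + 2 * κ ^ 2 * D + κ ^ 4 * C := by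
    rw [hA, hD, hC, ← intervalIntegral.integral_const_mul, ← intervalIntegral.integral_const_mul,
      ← intervalIntegral.integral_add (ii (by fun_prop)) (ii (by fun_prop)),
      ← intervalIntegral.integral_add (ii (by fun_prop)) (ii (by fun_prop))]
    refine intervalIntegral.integral_nonneg zero_le_one fun z _ => ?_
    nlinarith [sq_nonneg ((κ ^ 2 * φ z + f z) + κ ^ 2 * φ z)]
  have hDB : D = -B := by linarith
  rw [hDB] at e1 e2
  have hκB : 0 ≤ κ ^ 2 * B := by positivity
  have hκC : 0 ≤ κ ^ 4 * C := by positivity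
  refine ⟨by linarith, by linarith, by linarith, ?_⟩
  rw [← htrace]
  have e3 : ∫ z in (0 : ℝ)..1, (2 * φ z ^ 2 + (2 * z - 1) * (2 * φ z * φ' z)) ≤
      ∫ z in (0 : ℝ)..1, ((2 + 3 / 4 * κ) * φ z ^ 2 + (3 / 2 / κ) * φ' z ^ 2) := by
    refine intervalIntegral.integral_mono_on zero_le_one (ii (by fun_prop)) (ii (by fun_prop)) ?_
    intro z hz
    have h4 : |2 * z - 1| ≤ 1 := by rw [abs_le]; constructor <;> linarith [hz.1, hz.2]
    have h5 : (2 * z - 1) * (2 * φ z * φ' z) ≤ 2 * |φ z| * |φ' z| := by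
      calc _ ≤ |(2 * z - 1) * (2 * φ z * φ' z)| := le_abs_self _
        _ = |2 * z - 1| * (2 * |φ z| * |φ' z|) := by simp [abs_mul]
        _ ≤ 1 * (2 * |φ z| * |φ' z|) := by gcongr
        _ = _ := by ring
    have h6 : 2 * |φ z| * |φ' z| ≤ 3 / 4 * κ * φ z ^ 2 + (3 / 2 / κ) * φ' z ^ 2 := by
      rw [← sq_abs (φ z), ← sq_abs (φ' z)]
      have : 0 ≤ (3 / 4 * κ * |φ z| ^ 2 + (3 / 2 / κ) * |φ' z| ^ 2 - 2 * |φ z| * |φ' z|) := by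
        have : (3 / 4 * κ * |φ z| ^ 2 + (3 / 2 / κ) * |φ' z| ^ 2 - 2 * |φ z| * |φ' z|) =
          (3 / 4 * (κ * |φ z| - 4 / 3 * |φ' z|) ^ 2 + 1 / 6 * |φ' z| ^ 2) / κ := by
          field_simp; ring
        rw [this]; positivity
      linarith
    linarith
  rw [intervalIntegral.integral_add (f := fun z => (2 + 3 / 4 * κ) * φ z ^ 2)
    (ii (by fun_prop)) (ii (by fun_prop)),
    intervalIntegral.integral_const_mul, intervalIntegral.integral_const_mul] at e3
  calc _ ≤ κ ^ 2 * ((2 + 3 / 4 * κ) * C + 3 / 2 / κ * B) := by gcongr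
    _ = (2 / κ ^ 2) * (κ ^ 4 * C) + 3 / (4 * κ) * (κ ^ 4 * C + 2 * (κ ^ 2 * B)) := by
      field_simp; ring
    _ ≤ (2 / κ ^ 2) * I + 3 / (4 * κ) * I := by
      gcongr <;> linarith
    _ = _ := by ring

theorem hasDerivAt_max_zero_pow (n : ℕ) (t : ℝ) :
    HasDerivAt (fun t : ℝ => max 0 t ^ (n + 2)) ((n + 2) * max 0 t ^ (n + 1)) t := by
  rcases lt_trichotomy t 0 with ht | rfl | ht
  · have : (fun t : ℝ => max 0 t ^ (n + 2)) =ᶠ[nhds t] fun _ => 0 := by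
      filter_upwards [gt_mem_nhds ht] with s hs
      simp [max_eq_left hs.le]
    rw [max_eq_left ht.le]
    simpa using (hasDerivAt_const t (0 : ℝ)).congr_of_eventuallyEq this
  · have h : HasDerivAt (fun t : ℝ => t ^ (n + 2)) 0 0 := by
      simpa using hasDerivAt_pow (n + 2) (0 : ℝ)
    rw [hasDerivAt_iff_isLittleO_nhds_zero] at h ⊢
    refine Asymptotics.IsBigO.trans_isLittleO ?_ h
    refine Asymptotics.IsBigO.of_bound 1 (Filter.Eventually.of_forall fun s => ?_)
    simp only [zero_add, max_self, ne_eq, Nat.add_eq_zero_iff, OfNat.ofNat_ne_zero, and_false,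
      not_false_eq_true, zero_pow, sub_zero, smul_zero, one_ne_zero, mul_zero, norm_pow, one_mul,
      Real.norm_eq_abs]
    refine pow_le_pow_left₀ (abs_nonneg _) ?_ _
    rw [abs_of_nonneg (le_max_left _ _)]
    exact max_le (abs_nonneg _) (le_abs_self _)
  · have : (fun t : ℝ => max 0 t ^ (n + 2)) =ᶠ[nhds t] fun t => t ^ (n + 2) := by
      filter_upwards [lt_mem_nhds ht] with s hs
      simp [max_eq_right hs.le]
    rw [max_eq_right ht.le]
    simpa using (hasDerivAt_pow (n + 2) t).congr_of_eventuallyEq this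

/-- A `C²` boundary layer profile of width `δ`. -/
theorem exists_layer {δ : ℝ} (hδ : 0 < δ) (hδ1 : δ ≤ 1) :
    ∃ w w' w'' : ℝ → ℝ, (∀ z, HasDerivAt w (w' z) z) ∧ (∀ z, HasDerivAt w' (w'' z) z) ∧
      Continuous w'' ∧ w 0 = 0 ∧ w' 0 = 1 ∧
      (∀ z, δ ≤ z → w z = 0 ∧ w' z = 0 ∧ w'' z = 0) ∧
      (∫ z in (0 : ℝ)..1, w'' z ^ 2) = 24 / (5 * δ) ∧
      (∫ z in (0 : ℝ)..1, w' z ^ 2) = 3 * δ / 35 ∧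
      (∫ z in (0 : ℝ)..1, w z ^ 2) = δ ^ 3 / 252 := by
  set r : ℝ → ℝ := fun z => max 0 (1 - z / δ) with hr
  have hr3 : ∀ z, HasDerivAt (fun z => r z ^ 3) (-3 * r z ^ 2 / δ) z := by
    intro z
    have h := (hasDerivAt_max_zero_pow 1 (1 - z / δ)).comp z
      (((hasDerivAt_id z).div_const δ).const_sub 1)
    refine h.congr_deriv ?_
    simp only [hr, Nat.cast_one, Nat.reduceAdd]
    ring
  have hr2 : ∀ z, HasDerivAt (fun z => r z ^ 2) (-2 * r z / δ) z := by
    intro z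
    have h := (hasDerivAt_max_zero_pow 0 (1 - z / δ)).comp z
      (((hasDerivAt_id z).div_const δ).const_sub 1)
    refine h.congr_deriv ?_
    simp only [hr, CharP.cast_eq_zero, zero_add, pow_one]
    ring
  have hrc : Continuous r := by
    simp only [hr]
    fun_prop
  have hr0 : ∀ z, δ ≤ z → r z = 0 := fun z hz =>
    max_eq_left (by rw [sub_nonpos, le_div_iff₀ hδ]; linarith)
  have hri : ∀ z ∈ Icc 0 δ, r z = 1 - z / δ := fun z hz =>
    max_eq_right (by rw [sub_nonneg, div_le_iff₀ hδ]; linarith [hz.2])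
  have hr1 : r 0 = 1 := by simp [hr]
  have key : ∀ (g : ℝ → ℝ → ℝ) (G : ℝ → ℝ), Continuous (fun z => g z (r z)) →
      (∀ z, HasDerivAt G (g z (1 - z / δ)) z) → (∀ z, g z 0 = 0) →
      ∫ z in (0 : ℝ)..1, g z (r z) = G δ - G 0 := by
    intro g G hg hG hg0
    rw [← intervalIntegral.integral_add_adjacent_intervals (hg.intervalIntegrable 0 δ)
      (hg.intervalIntegrable δ 1)]
    have h2 : ∫ z in δ..1, g z (r z) = 0 := by
      rw [intervalIntegral.integral_congr (g := fun _ => (0 : ℝ))]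
      · simp
      · intro z hz
        rw [uIcc_of_le hδ1] at hz
        simp [hr0 z hz.1, hg0]
    have h1 : ∀ z ∈ uIcc 0 δ, g z (r z) = g z (1 - z / δ) := by
      intro z hz
      rw [uIcc_of_le hδ.le] at hz
      rw [hri z hz]
    rw [h2, add_zero]
    refine intervalIntegral.integral_eq_sub_of_hasDerivAt (fun z hz => ?_)
      (hg.intervalIntegrable _ _)
    rw [h1 z hz]
    exact hG z
  have hp : ∀ (n : ℕ) (z : ℝ), HasDerivAt (fun z => (1 - z / δ) ^ (n + 1))
      ((n + 1) * (1 - z / δ) ^ n * (-1 / δ)) z := by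
    intro n z
    have := (((hasDerivAt_id z).div_const δ).const_sub 1).pow (n + 1)
    refine this.congr_deriv ?_
    simp [neg_div]
  refine ⟨fun z => z * r z ^ 3, fun z => r z ^ 3 - 3 * (z / δ) * r z ^ 2,
    fun z => (-6 * r z ^ 2 + 6 * (z / δ) * r z) / δ, ?_, ?_, by fun_prop, by simp,
    by simp [hr1], ?_, ?_, ?_, ?_⟩
  · intro z
    refine ((hasDerivAt_id z).mul (hr3 z)).congr_deriv ?_
    simp only [id]
    ring
  · intro z
    refine ((hr3 z).sub ((((hasDerivAt_id z).div_const δ).const_mul 3).mul (hr2 z))).congr_deriv ?_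
    simp only [id]
    ring
  · intro z hz
    simp [hr0 z hz]
  · rw [key (fun z s => ((-6 * s ^ 2 + 6 * (z / δ) * s) / δ) ^ 2)
      (fun z => -(1 / δ) * (144 / 5 * (1 - z / δ) ^ (4 + 1) - 36 * (1 - z / δ) ^ (3 + 1)
        + 12 * (1 - z / δ) ^ (2 + 1))) (by fun_prop) ?_ (by simp)]
    · simp only [div_self hδ.ne', sub_self, zero_div, sub_zero]
      field_simp; norm_num
    · intro z
      refine ((((hp 4 z).const_mul (144 / 5)).sub ((hp 3 z).const_mul 36)).add
        ((hp 2 z).const_mul 12)).const_mul (-(1 / δ)) |>.congr_deriv ?_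
      push_cast
      field_simp; ring
  · rw [key (fun z s => (s ^ 3 - 3 * (z / δ) * s ^ 2) ^ 2)
      (fun z => -δ * (16 / 7 * (1 - z / δ) ^ (6 + 1) - 4 * (1 - z / δ) ^ (5 + 1)
        + 9 / 5 * (1 - z / δ) ^ (4 + 1))) (by fun_prop) ?_ (by simp)]
    · simp only [div_self hδ.ne', sub_self, zero_div, sub_zero]
      field_simp; norm_num
    · intro z
      refine ((((hp 6 z).const_mul (16 / 7)).sub ((hp 5 z).const_mul 4)).add
        ((hp 4 z).const_mul (9 / 5))).const_mul (-δ) |>.congr_deriv ?_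
      push_cast
      field_simp; ring
  · rw [key (fun z s => (z * s ^ 3) ^ 2)
      (fun z => -δ ^ 3 * (1 / 9 * (1 - z / δ) ^ (8 + 1) - 1 / 4 * (1 - z / δ) ^ (7 + 1)
        + 1 / 7 * (1 - z / δ) ^ (6 + 1))) (by fun_prop) ?_ (by simp)]
    · simp only [div_self hδ.ne', sub_self, zero_div, sub_zero]
      field_simp; norm_num
    · intro z
      refine ((((hp 8 z).const_mul (1 / 9)).sub ((hp 7 z).const_mul (1 / 4))).add
        ((hp 6 z).const_mul (1 / 7))).const_mul (-δ ^ 3) |>.congr_deriv ?_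
      push_cast
      field_simp; ring

/-- A stream function on `[0,1]` vanishing at both ends with prescribed slopes there. -/
theorem exists_corrector {δ : ℝ} (hδ : 0 < δ) (hδ1 : δ ≤ 1 / 2) (a b : ℝ) :
    ∃ ψ ψ' ψ'' : ℝ → ℝ, (∀ z, HasDerivAt ψ (ψ' z) z) ∧ (∀ z, HasDerivAt ψ' (ψ'' z) z) ∧
      Continuous ψ'' ∧ ψ 0 = 0 ∧ ψ 1 = 0 ∧ ψ' 0 = a ∧ ψ' 1 = b ∧
      (∫ z in (0 : ℝ)..1, ψ'' z ^ 2) = (a ^ 2 + b ^ 2) * (24 / (5 * δ)) ∧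
      (∫ z in (0 : ℝ)..1, ψ' z ^ 2) = (a ^ 2 + b ^ 2) * (3 * δ / 35) ∧
      (∫ z in (0 : ℝ)..1, ψ z ^ 2) = (a ^ 2 + b ^ 2) * (δ ^ 3 / 252) := by
  obtain ⟨w, w', w'', h1, h2, hc, h0, h0', hv, i2, i1, i0⟩ := exists_layer hδ (by linarith)
  have cw : Continuous w := continuous_iff_continuousAt.2 fun z => (h1 z).continuousAt
  have cw' : Continuous w' := continuous_iff_continuousAt.2 fun z => (h2 z).continuousAt
  have hs : ∀ z : ℝ, HasDerivAt (fun z : ℝ => 1 - z) (-1) z := fun z =>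
    (hasDerivAt_id z).const_sub 1
  have hv1 := hv 1 (by linarith)
  have hdis : ∀ z, w z * w (1 - z) = 0 ∧ w' z * w' (1 - z) = 0 ∧ w'' z * w'' (1 - z) = 0 := by
    intro z
    rcases le_total δ z with h | h
    · simp [hv z h]
    · simp [hv (1 - z) (by linarith)]
  have key : ∀ (g G : ℝ → ℝ) (J : ℝ), Continuous g → (∫ z in (0 : ℝ)..1, g z ^ 2) = J →
      (∀ z, G z ^ 2 = a ^ 2 * g z ^ 2 + b ^ 2 * g (1 - z) ^ 2) →
      ∫ z in (0 : ℝ)..1, G z ^ 2 = (a ^ 2 + b ^ 2) * J := by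
    intro g G J hg hJ hG
    have hsub : ∫ z in (0 : ℝ)..1, g (1 - z) ^ 2 = J := by
      rw [intervalIntegral.integral_comp_sub_left (fun z => g z ^ 2)]
      simpa using hJ
    simp_rw [hG]
    rw [intervalIntegral.integral_add, intervalIntegral.integral_const_mul,
      intervalIntegral.integral_const_mul, hJ, hsub]
    · ring
    · exact Continuous.intervalIntegrable (by fun_prop) _ _
    · exact Continuous.intervalIntegrable (by fun_prop) _ _
  refine ⟨fun z => a * w z - b * w (1 - z), fun z => a * w' z + b * w' (1 - z),
    fun z => a * w'' z - b * w'' (1 - z), ?_, ?_, by fun_prop, by simp [h0, hv1],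
    by simp [h0, hv1], by simp [h0', hv1], by simp [h0', hv1],
    key w'' _ _ hc i2 fun z => ?_, key w' _ _ cw' i1 fun z => ?_, key w _ _ cw i0 fun z => ?_⟩
  · intro z
    refine (((h1 z).const_mul a).sub
      (((h1 (1 - z)).comp z (hs z)).const_mul b)).congr_deriv ?_
    ring
  · intro z
    refine (((h2 z).const_mul a).add
      (((h2 (1 - z)).comp z (hs z)).const_mul b)).congr_deriv ?_
    ring
  · linear_combination (-2 * a * b) * (hdis z).2.2
  · linear_combination (2 * a * b) * (hdis z).2.1
  · linear_combination (-2 * a * b) * (hdis z).1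

theorem contDiff_one_of_hasDerivAt {g g' : ℝ → ℝ} (h : ∀ z, HasDerivAt g (g' z) z)
    (hc : Continuous g') : ContDiff ℝ 1 g := by
  rw [contDiff_one_iff_deriv]
  refine ⟨fun z => (h z).differentiableAt, ?_⟩
  rwa [funext fun z => (h z).deriv]

theorem integral_add_sq_le {g h : ℝ → ℝ} (hg : Continuous g) (hh : Continuous h) {t : ℝ}
    (ht : 0 < t) :
    ∫ z in (0 : ℝ)..1, (g z + h z) ^ 2 ≤
      (1 + t) * (∫ z in (0 : ℝ)..1, g z ^ 2) + (1 + 1 / t) * ∫ z in (0 : ℝ)..1, h z ^ 2 := by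
  rw [← intervalIntegral.integral_const_mul, ← intervalIntegral.integral_const_mul,
    ← intervalIntegral.integral_add (Continuous.intervalIntegrable (by fun_prop) _ _)
      (Continuous.intervalIntegrable (by fun_prop) _ _)]
  refine intervalIntegral.integral_mono_on zero_le_one
    (Continuous.intervalIntegrable (by fun_prop) _ _)
    (Continuous.intervalIntegrable (by fun_prop) _ _) fun z _ => ?_
  have : (1 + t) * g z ^ 2 + (1 + 1 / t) * h z ^ 2 - (g z + h z) ^ 2 =
      (t * g z - h z) ^ 2 / t := by field_simp; ring
  have h2 : 0 ≤ (t * g z - h z) ^ 2 / t := by positivity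
  linarith

/-- Width of the boundary layer at wave number `κ`, and the resulting bounds on the corrector. -/
theorem exists_layer_width {κ D : ℝ} (hκ : 0 < κ) (hD : 4 ≤ D) (hκD : 6 ≤ κ * D) :
    ∃ δ : ℝ, 0 < δ ∧ δ ≤ 1 / 2 ∧
      (2 / κ ^ 2 + 3 / (4 * κ)) * (24 / (5 * δ)) ≤ 5 / 6 * D ^ 2 ∧
      κ ^ 2 * ((2 / κ ^ 2 + 3 / (4 * κ)) * (3 * δ / 35)) ≤ 0.343 ∧
      κ ^ 4 * ((2 / κ ^ 2 + 3 / (4 * κ)) * (δ ^ 3 / 252)) ≤ 0.255 := by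
  rcases le_total κ 8 with h | h
  · refine ⟨1 / 2, by norm_num, le_rfl, ?_, ?_, ?_⟩
    · have h1 : 1 / κ ≤ D / 6 := by rw [div_le_div_iff₀ hκ (by norm_num)]; linarith
      have h2 : (1 / κ) ^ 2 ≤ (D / 6) ^ 2 := by gcongr
      have : (2 / κ ^ 2 + 3 / (4 * κ)) * (24 / (5 * (1 / 2))) =
        9.6 * (2 * (1 / κ) ^ 2 + 0.75 * (1 / κ)) := by field_simp; ring
      rw [this]
      nlinarith
    · have : κ ^ 2 * ((2 / κ ^ 2 + 3 / (4 * κ)) * (3 * (1 / 2) / 35)) =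
        (2 + 0.75 * κ) * 3 / 70 := by field_simp; ring
      rw [this]; linarith
    · have : κ ^ 4 * ((2 / κ ^ 2 + 3 / (4 * κ)) * ((1 / 2) ^ 3 / 252)) =
        (2 * κ ^ 2 + 0.75 * κ ^ 3) / 2016 := by field_simp; ring
      rw [this]
      have h2 : κ ^ 2 ≤ 8 ^ 2 := by gcongr
      have h3 : κ ^ 3 ≤ 8 ^ 3 := by gcongr
      linarith
  · have h1 : 1 / κ ≤ 1 / 8 := by gcongr
    refine ⟨4 / κ, by positivity, by rw [div_le_div_iff₀ hκ (by norm_num)]; linarith, ?_, ?_, ?_⟩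
    · have : (2 / κ ^ 2 + 3 / (4 * κ)) * (24 / (5 * (4 / κ))) =
        1.2 * (2 * (1 / κ) + 0.75) := by field_simp; ring
      rw [this]
      nlinarith
    · have : κ ^ 2 * ((2 / κ ^ 2 + 3 / (4 * κ)) * (3 * (4 / κ) / 35)) =
        (2 * (1 / κ) + 0.75) * 12 / 35 := by field_simp; ring
      rw [this]; linarith
    · have : κ ^ 4 * ((2 / κ ^ 2 + 3 / (4 * κ)) * ((4 / κ) ^ 3 / 252)) =
        (2 * (1 / κ) + 0.75) * 64 / 252 := by field_simp; ring
      rw [this]; linarith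

/-- Solution of the divergence equation at one wave number, in unit height. -/
theorem exists_mode_unit {κ D : ℝ} (hκ : 0 < κ) (hD : 4 ≤ D) (hκD : 6 ≤ κ * D) {f : ℝ → ℝ}
    (hf : Continuous f) :
    ∃ a b : ℝ → ℝ, ContDiff ℝ 1 a ∧ ContDiff ℝ 1 b ∧ a 0 = 0 ∧ a 1 = 0 ∧ b 0 = 0 ∧ b 1 = 0 ∧
      (∀ z, κ * a z + deriv b z = f z) ∧
      (∫ z in (0 : ℝ)..1, deriv a z ^ 2) ≤ 1.08 * D ^ 2 * ∫ z in (0 : ℝ)..1, f z ^ 2 ∧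
      κ ^ 2 * (∫ z in (0 : ℝ)..1, a z ^ 2) ≤ 2.6 * ∫ z in (0 : ℝ)..1, f z ^ 2 ∧
      (∫ z in (0 : ℝ)..1, deriv b z ^ 2) ≤ 2.6 * ∫ z in (0 : ℝ)..1, f z ^ 2 ∧
      κ ^ 2 * (∫ z in (0 : ℝ)..1, b z ^ 2) ≤ 1.02 * ∫ z in (0 : ℝ)..1, f z ^ 2 := by
  obtain ⟨φ, φ', h1, h2, h0, h3⟩ := exists_neumann_solution hκ hf
  obtain ⟨eA, eC, eB, eG⟩ := neumann_energy hκ hf h1 h2 h0 h3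
  obtain ⟨δ, hδ, hδ2, b2, b1, b0⟩ := exists_layer_width hκ hD hκD
  obtain ⟨ψ, ψ', ψ'', g1, g2, gc, p0, p1, s0, s1, j2, j1, j0⟩ :=
    exists_corrector hδ hδ2 (κ * φ 0) (κ * φ 1)
  have cφ : Continuous φ := continuous_iff_continuousAt.2 fun z => (h1 z).continuousAt
  have cφ' : Continuous φ' := continuous_iff_continuousAt.2 fun z => (h2 z).continuousAt
  have cψ : Continuous ψ := continuous_iff_continuousAt.2 fun z => (g1 z).continuousAt
  have cψ' : Continuous ψ' := continuous_iff_continuousAt.2 fun z => (g2 z).continuousAt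
  have ha : ∀ z, HasDerivAt (fun z => -κ * φ z + ψ' z) (-κ * φ' z + ψ'' z) z := fun z =>
    ((h1 z).const_mul (-κ)).add (g2 z)
  have hb : ∀ z, HasDerivAt (fun z => φ' z + -κ * ψ z) ((κ ^ 2 * φ z + f z) + -κ * ψ' z) z :=
    fun z => (h2 z).add ((g1 z).const_mul (-κ))
  have hda := funext fun z => (ha z).deriv
  have hdb := funext fun z => (hb z).deriv
  set I := ∫ z in (0 : ℝ)..1, f z ^ 2 with hI
  have hIn : 0 ≤ I := intervalIntegral.integral_nonneg zero_le_one fun z _ => sq_nonneg _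
  have hG : (κ * φ 0) ^ 2 + (κ * φ 1) ^ 2 ≤ (2 / κ ^ 2 + 3 / (4 * κ)) * I := by
    calc _ = κ ^ 2 * (φ 0 ^ 2 + φ 1 ^ 2) := by ring
      _ ≤ _ := eG
  have k2 : (∫ z in (0 : ℝ)..1, ψ'' z ^ 2) ≤ 5 / 6 * D ^ 2 * I := by
    rw [j2]
    calc _ ≤ (2 / κ ^ 2 + 3 / (4 * κ)) * I * (24 / (5 * δ)) := by gcongr
      _ = (2 / κ ^ 2 + 3 / (4 * κ)) * (24 / (5 * δ)) * I := by ring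
      _ ≤ _ := by gcongr
  have k1 : κ ^ 2 * (∫ z in (0 : ℝ)..1, ψ' z ^ 2) ≤ 0.343 * I := by
    rw [j1]
    calc _ ≤ κ ^ 2 * ((2 / κ ^ 2 + 3 / (4 * κ)) * I * (3 * δ / 35)) := by gcongr
      _ = κ ^ 2 * ((2 / κ ^ 2 + 3 / (4 * κ)) * (3 * δ / 35)) * I := by ring
      _ ≤ _ := by gcongr
  have k0 : κ ^ 4 * (∫ z in (0 : ℝ)..1, ψ z ^ 2) ≤ 0.255 * I := by
    rw [j0]
    calc _ ≤ κ ^ 4 * ((2 / κ ^ 2 + 3 / (4 * κ)) * I * (δ ^ 3 / 252)) := by gcongr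
      _ = κ ^ 4 * ((2 / κ ^ 2 + 3 / (4 * κ)) * (δ ^ 3 / 252)) * I := by ring
      _ ≤ _ := by gcongr
  have hcm : ∀ (c : ℝ) (g : ℝ → ℝ), (∫ z in (0 : ℝ)..1, (c * g z) ^ 2) =
      c ^ 2 * ∫ z in (0 : ℝ)..1, g z ^ 2 := by
    intro c g
    simp_rw [mul_pow]
    rw [intervalIntegral.integral_const_mul]
  refine ⟨_, _, contDiff_one_of_hasDerivAt ha (by fun_prop),
    contDiff_one_of_hasDerivAt hb (by fun_prop), by simp [s0], by simp [s1], by simp [h0, p0],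
    by simp [h3, p1], fun z => ?_, ?_, ?_, ?_, ?_⟩
  · rw [hdb]; ring
  · rw [hda]
    have := integral_add_sq_le (g := fun z => -κ * φ' z) (by fun_prop) gc (t := 7) (by norm_num)
    rw [hcm, neg_sq] at this
    have hDI : 16 * I ≤ D ^ 2 * I := by gcongr; nlinarith
    linarith
  · have := integral_add_sq_le (g := fun z => -κ * φ z) (by fun_prop) cψ' (t := 3 / 5)
      (by norm_num)
    rw [hcm, neg_sq] at this
    refine (mul_le_mul_of_nonneg_left this (sq_nonneg κ)).trans ?_
    ring_nf at *
    linarith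
  · rw [hdb]
    have := integral_add_sq_le (g := fun z => κ ^ 2 * φ z + f z) (h := fun z => -κ * ψ' z)
      (by fun_prop) (by fun_prop) (t := 3 / 5) (by norm_num)
    rw [hcm, neg_sq] at this
    linarith
  · have := integral_add_sq_le (h := fun z => -κ * ψ z) cφ' (by fun_prop) (t := 1)
      (by norm_num)
    rw [hcm, neg_sq] at this
    refine (mul_le_mul_of_nonneg_left this (sq_nonneg κ)).trans ?_
    ring_nf at *
    linarith

/-- Solution of the divergence equation at the signed wave number `k`, with the anisotropic bounds
for height `H`. -/
theorem exists_mode {H k D : ℝ} (hH : 0 < H) (hD : 4 ≤ D) (hkD : k ≠ 0 → 6 ≤ |k| * H * D)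
    {f : ℝ → ℝ} (hf : Continuous f) (hf0 : k = 0 → ∫ z in (0 : ℝ)..1, f z = 0) :
    ∃ a b : ℝ → ℝ, ContDiff ℝ 1 a ∧ ContDiff ℝ 1 b ∧ a 0 = 0 ∧ a 1 = 0 ∧ b 0 = 0 ∧ b 1 = 0 ∧
      (∀ z, -k * a z + deriv b z = f z) ∧
      (∫ z in (0 : ℝ)..1, deriv a z ^ 2) ≤ 1.08 * D ^ 2 * H ^ 2 * ∫ z in (0 : ℝ)..1, f z ^ 2 ∧
      k ^ 2 * (∫ z in (0 : ℝ)..1, a z ^ 2) ≤ 2.6 * ∫ z in (0 : ℝ)..1, f z ^ 2 ∧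
      (∫ z in (0 : ℝ)..1, deriv b z ^ 2) ≤ 2.6 * ∫ z in (0 : ℝ)..1, f z ^ 2 ∧
      H ^ 2 * (k ^ 2 * ∫ z in (0 : ℝ)..1, b z ^ 2) ≤ 1.02 * ∫ z in (0 : ℝ)..1, f z ^ 2 := by
  have hIn : 0 ≤ ∫ z in (0 : ℝ)..1, f z ^ 2 :=
    intervalIntegral.integral_nonneg zero_le_one fun z _ => sq_nonneg _
  by_cases hk : k = 0
  · subst hk
    have hb : ∀ z, HasDerivAt (fun z => ∫ s in (0 : ℝ)..z, f s) (f z) z := fun z =>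
      intervalIntegral.integral_hasDerivAt_right (hf.intervalIntegrable _ _)
        (hf.stronglyMeasurableAtFilter _ _) hf.continuousAt
    refine ⟨fun _ => 0, _, contDiff_const, contDiff_one_of_hasDerivAt hb hf, rfl, rfl, by simp,
      hf0 rfl, fun z => by simp [(hb z).deriv], ?_, ?_, ?_, ?_⟩
    · simp only [deriv_const]
      norm_num
      positivity
    · norm_num
      linarith
    · rw [funext fun z => (hb z).deriv]
      linarith
    · norm_num
      linarith
  · have hκ : 0 < |k| * H := by positivity
    obtain ⟨a, b, ca, cb, a0, a1, b0, b1, he, e1, e2, e3, e4⟩ :=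
      exists_mode_unit hκ hD (hkD hk) hf
    have hs : (SignType.sign k : ℝ) * |k| = k := sign_mul_abs k
    have hs2 : ((SignType.sign k : ℝ)) ^ 2 = 1 := by
      rcases lt_or_gt_of_ne hk with h | h <;> simp [h]
    set s : ℝ := (SignType.sign k : ℝ) with hsdef
    have hda : deriv (fun z => -s * H * a z) = fun z => -s * H * deriv a z :=
      funext fun z => deriv_const_mul_field (-s * H)
    have hcm : ∀ (c : ℝ) (g : ℝ → ℝ), (∫ z in (0 : ℝ)..1, (c * g z) ^ 2) =
        c ^ 2 * ∫ z in (0 : ℝ)..1, g z ^ 2 := by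
      intro c g
      simp_rw [mul_pow]
      rw [intervalIntegral.integral_const_mul]
    have hc2 : (-s * H) ^ 2 = H ^ 2 := by
      calc _ = s ^ 2 * H ^ 2 := by ring
        _ = _ := by rw [hs2, one_mul]
    refine ⟨fun z => -s * H * a z, b, contDiff_const.mul ca, cb, by simp [a0], by simp [a1], b0,
      b1, fun z => ?_, ?_, ?_, e3, ?_⟩
    · rw [← he z]
      have : k * s = |k| := by
        calc k * s = s * |k| * s := by rw [hs]
          _ = s ^ 2 * |k| := by ring
          _ = _ := by rw [hs2, one_mul]
      linear_combination H * a z * this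
    · rw [hda, hcm, hc2]
      calc _ ≤ H ^ 2 * (1.08 * D ^ 2 * ∫ z in (0 : ℝ)..1, f z ^ 2) := by gcongr
        _ = _ := by ring
    · rw [hcm, hc2]
      rw [mul_pow, sq_abs] at e2
      linarith
    · rw [mul_pow, sq_abs] at e4
      linarith

theorem fderiv_fst_eq {U : ℝ × ℝ → ℝ} {x y d : ℝ} (hU : DifferentiableAt ℝ U (x, y))
    (h : HasDerivAt (fun t => U (t, y)) d x) : fderiv ℝ U (x, y) (1, 0) = d := by
  have h1 : HasDerivAt (fun t : ℝ => (t, y)) ((1 : ℝ), (0 : ℝ)) x :=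
    (hasDerivAt_id x).prodMk (hasDerivAt_const x y)
  exact (hU.hasFDerivAt.comp_hasDerivAt x h1).unique h

theorem fderiv_snd_eq {U : ℝ × ℝ → ℝ} {x y d : ℝ} (hU : DifferentiableAt ℝ U (x, y))
    (h : HasDerivAt (fun t => U (x, t)) d y) : fderiv ℝ U (x, y) (0, 1) = d := by
  have h1 : HasDerivAt (fun t : ℝ => (x, t)) ((0 : ℝ), (1 : ℝ)) y :=
    (hasDerivAt_const y x).prodMk (hasDerivAt_id y)
  exact (hU.hasFDerivAt.comp_hasDerivAt y h1).unique h

/-- The wave number `2πn/L`. -/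
noncomputable def waveNumber (L : ℝ) (n : ℤ) : ℝ := 2 * Real.pi * n / L

/-- The Hartley basis function `cos + sin` of wave number `2πn/L`. -/
noncomputable def hartley (L : ℝ) (n : ℤ) (x : ℝ) : ℝ :=
  Real.cos (waveNumber L n * x) + Real.sin (waveNumber L n * x)

/-- A Hartley polynomial in `x` with coefficients depending on `z`. -/
noncomputable def hartleySum (L : ℝ) (S : Finset ℤ) (e : ℤ → ℤ) (c : ℤ → ℝ → ℝ) (p : ℝ × ℝ) : ℝ :=
  ∑ n ∈ S, c n p.2 * hartley L (e n) p.1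

theorem waveNumber_neg (L : ℝ) (n : ℤ) : waveNumber L (-n) = -waveNumber L n := by
  simp [waveNumber, neg_div]

theorem hartley_add_period {L : ℝ} (hL : L ≠ 0) (n : ℤ) (x : ℝ) :
    hartley L n (x + L) = hartley L n x := by
  have : waveNumber L n * (x + L) = waveNumber L n * x + n * (2 * Real.pi) := by
    simp only [waveNumber]; field_simp
  simp only [hartley, this, Real.cos_add_int_mul_two_pi, Real.sin_add_int_mul_two_pi]

theorem contDiff_hartley (L : ℝ) (n : ℤ) : ContDiff ℝ 1 (hartley L n) := by
  unfold hartley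
  fun_prop

theorem hasDerivAt_hartley (L : ℝ) (n : ℤ) (x : ℝ) :
    HasDerivAt (hartley L n) (waveNumber L n * hartley L (-n) x) x := by
  have h := (hasDerivAt_id x).const_mul (waveNumber L n)
  refine (h.cos.add h.sin).congr_deriv ?_
  simp only [hartley, waveNumber_neg, id, neg_mul, Real.cos_neg, Real.sin_neg]
  ring

theorem hartley_mul_hartley (L : ℝ) (n m : ℤ) (x : ℝ) :
    hartley L n x * hartley L m x =
      Real.cos (waveNumber L (n - m) * x) + Real.sin (waveNumber L (n + m) * x) := by
  have h1 : waveNumber L (n - m) * x = waveNumber L n * x - waveNumber L m * x := by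
    simp only [waveNumber]; push_cast; ring
  have h2 : waveNumber L (n + m) * x = waveNumber L n * x + waveNumber L m * x := by
    simp only [waveNumber]; push_cast; ring
  rw [h1, h2, Real.cos_sub, Real.sin_add, hartley, hartley]
  ring

theorem waveNumber_ne_zero {L : ℝ} (hL : L ≠ 0) {n : ℤ} (hn : n ≠ 0) : waveNumber L n ≠ 0 := by
  have : (n : ℝ) ≠ 0 := Int.cast_ne_zero.2 hn
  have := Real.pi_ne_zero
  unfold waveNumber
  positivity

theorem integral_cos_waveNumber {L : ℝ} (hL : L ≠ 0) (n : ℤ) :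
    ∫ x in (0 : ℝ)..L, Real.cos (waveNumber L n * x) = if n = 0 then L else 0 := by
  split_ifs with h
  · simp [h, waveNumber]
  · have : waveNumber L n * L = n * (2 * Real.pi) := by
      simp only [waveNumber]; field_simp
    rw [intervalIntegral.integral_comp_mul_left _ (waveNumber_ne_zero hL h), this]
    have h0 : Real.sin (n * (2 * Real.pi)) = 0 := by
      simpa using Real.sin_add_int_mul_two_pi 0 n
    simp [h0]

theorem integral_sin_waveNumber {L : ℝ} (hL : L ≠ 0) (n : ℤ) :
    ∫ x in (0 : ℝ)..L, Real.sin (waveNumber L n * x) = 0 := by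
  by_cases h : n = 0
  · simp [h, waveNumber]
  · have : waveNumber L n * L = n * (2 * Real.pi) := by
      simp only [waveNumber]; field_simp
    rw [intervalIntegral.integral_comp_mul_left _ (waveNumber_ne_zero hL h), this]
    simp

theorem integral_hartley_mul {L : ℝ} (hL : L ≠ 0) (n m : ℤ) :
    ∫ x in (0 : ℝ)..L, hartley L n x * hartley L m x = if n = m then L else 0 := by
  simp_rw [hartley_mul_hartley]
  rw [intervalIntegral.integral_add (Continuous.intervalIntegrable (by fun_prop) _ _)
    (Continuous.intervalIntegrable (by fun_prop) _ _), integral_cos_waveNumber hL,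
    integral_sin_waveNumber hL, add_zero]
  simp [sub_eq_zero]

/-- Parseval's identity for Hartley polynomials. -/
theorem integral_hartleySum_sq {L : ℝ} (hL : L ≠ 0) (S : Finset ℤ) {e : ℤ → ℤ}
    (he : Function.Injective e) {c : ℤ → ℝ → ℝ} (hc : ∀ n, Continuous (c n)) :
    ∫ x in (0 : ℝ)..L, ∫ z in (0 : ℝ)..1, hartleySum L S e c (x, z) ^ 2 =
      L * ∑ n ∈ S, ∫ z in (0 : ℝ)..1, c n z ^ 2 := by
  have hh : ∀ n, Continuous (hartley L n) := fun n => (contDiff_hartley L n).continuous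
  have h1 : ∀ x, ∫ z in (0 : ℝ)..1, hartleySum L S e c (x, z) ^ 2 =
      ∑ n ∈ S, ∑ m ∈ S, (∫ z in (0 : ℝ)..1, c n z * c m z) *
        (hartley L (e n) x * hartley L (e m) x) := by
    intro x
    simp only [hartleySum, sq, Finset.sum_mul_sum]
    rw [intervalIntegral.integral_finsetSum fun n _ =>
      Continuous.intervalIntegrable (by have := hc; fun_prop) _ _]
    refine Finset.sum_congr rfl fun n _ => ?_
    rw [intervalIntegral.integral_finsetSum fun m _ =>
      Continuous.intervalIntegrable (by have := hc; fun_prop) _ _]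
    refine Finset.sum_congr rfl fun m _ => ?_
    rw [← intervalIntegral.integral_mul_const]
    refine intervalIntegral.integral_congr fun z _ => ?_
    ring
  simp_rw [h1]
  rw [intervalIntegral.integral_finsetSum fun n _ =>
    Continuous.intervalIntegrable (by fun_prop) _ _, Finset.mul_sum]
  refine Finset.sum_congr rfl fun n hn => ?_
  rw [intervalIntegral.integral_finsetSum fun m _ =>
    Continuous.intervalIntegrable (by fun_prop) _ _, Finset.sum_eq_single n]
  · rw [intervalIntegral.integral_const_mul, integral_hartley_mul hL, if_pos rfl]
    simp_rw [sq]
    ring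
  · intro m _ hm
    rw [intervalIntegral.integral_const_mul, integral_hartley_mul hL,
      if_neg fun h => hm (he h).symm, mul_zero]
  · exact fun h => absurd hn h

theorem integral_hartleySum {L : ℝ} (hL : L ≠ 0) (S : Finset ℤ) {c : ℤ → ℝ → ℝ}
    (hc : ∀ n, Continuous (c n)) (h0 : (0 : ℤ) ∈ S) :
    ∫ x in (0 : ℝ)..L, ∫ z in (0 : ℝ)..1, hartleySum L S id c (x, z) =
      L * ∫ z in (0 : ℝ)..1, c 0 z := by
  have hh : ∀ n, Continuous (hartley L n) := fun n => (contDiff_hartley L n).continuous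
  have hz : ∀ n, ∫ x in (0 : ℝ)..L, hartley L n x = if n = 0 then L else 0 := by
    intro n
    have := integral_hartley_mul hL n 0
    simpa [hartley, waveNumber] using this
  simp only [hartleySum, id]
  have h1 : ∀ x, ∫ z in (0 : ℝ)..1, ∑ n ∈ S, c n z * hartley L n x =
      ∑ n ∈ S, (∫ z in (0 : ℝ)..1, c n z) * hartley L n x := by
    intro x
    rw [intervalIntegral.integral_finsetSum fun n _ =>
      Continuous.intervalIntegrable (by have := hc; fun_prop) _ _]
    simp_rw [intervalIntegral.integral_mul_const]
  simp_rw [h1]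
  rw [intervalIntegral.integral_finsetSum fun n _ =>
    Continuous.intervalIntegrable (by fun_prop) _ _]
  simp_rw [intervalIntegral.integral_const_mul, hz]
  simp [h0, mul_comm]

theorem contDiff_hartleySum (L : ℝ) (S : Finset ℤ) (e : ℤ → ℤ) {c : ℤ → ℝ → ℝ}
    (hc : ∀ n, ContDiff ℝ 1 (c n)) : ContDiff ℝ 1 (hartleySum L S e c) := by
  unfold hartleySum
  have := contDiff_hartley L
  fun_prop

theorem continuous_hartleySum (L : ℝ) (S : Finset ℤ) (e : ℤ → ℤ) {c : ℤ → ℝ → ℝ}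
    (hc : ∀ n, Continuous (c n)) : Continuous (hartleySum L S e c) := by
  unfold hartleySum
  have := fun n => (contDiff_hartley L n).continuous
  fun_prop

theorem hartleySum_add_period {L : ℝ} (hL : L ≠ 0) (S : Finset ℤ) (e : ℤ → ℤ) (c : ℤ → ℝ → ℝ)
    (x z : ℝ) : hartleySum L S e c (x + L, z) = hartleySum L S e c (x, z) := by
  simp [hartleySum, hartley_add_period hL]

theorem fderiv_hartleySum_fst (L : ℝ) (S : Finset ℤ) (e : ℤ → ℤ) {c : ℤ → ℝ → ℝ}
    (hc : ∀ n, ContDiff ℝ 1 (c n)) (p : ℝ × ℝ) :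
    fderiv ℝ (hartleySum L S e c) p (1, 0) =
      hartleySum L S (fun n => -e n) (fun n z => waveNumber L (e n) * c n z) p := by
  refine fderiv_fst_eq ((contDiff_hartleySum L S e hc).differentiable one_ne_zero _) ?_
  have := HasDerivAt.fun_sum fun n (_ : n ∈ S) =>
    (hasDerivAt_hartley L (e n) p.1).const_mul (c n p.2)
  refine this.congr_deriv ?_
  simp only [hartleySum]
  exact Finset.sum_congr rfl fun n _ => by ring

theorem fderiv_hartleySum_snd (L : ℝ) (S : Finset ℤ) (e : ℤ → ℤ) {c : ℤ → ℝ → ℝ}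
    (hc : ∀ n, ContDiff ℝ 1 (c n)) (p : ℝ × ℝ) :
    fderiv ℝ (hartleySum L S e c) p (0, 1) = hartleySum L S e (fun n => deriv (c n)) p := by
  refine fderiv_snd_eq ((contDiff_hartleySum L S e hc).differentiable one_ne_zero _) ?_
  have := HasDerivAt.fun_sum fun n (_ : n ∈ S) =>
    (((hc n).differentiable one_ne_zero) p.2).hasDerivAt.mul_const (hartley L (e n) p.1)
  exact this

/-- Right inverse of the divergence on the flat periodic strip of unit height, with bounds adapted
to a channel of height at least `H`. -/
theorem exists_strip_field {L H D : ℝ} (hL : 0 < L) (hH : 0 < H) (hD : 4 ≤ D) (hLD : L / H ≤ D)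
    (S : Finset ℤ) {f : ℤ → ℝ → ℝ} (hf : ∀ n, Continuous (f n))
    (hf0 : ∫ z in (0 : ℝ)..1, f 0 z = 0) :
    ∃ U V : ℝ × ℝ → ℝ, ContDiff ℝ 1 U ∧ ContDiff ℝ 1 V ∧
      (∀ x z, U (x + L, z) = U (x, z)) ∧ (∀ x z, V (x + L, z) = V (x, z)) ∧
      (∀ x, U (x, 0) = 0) ∧ (∀ x, U (x, 1) = 0) ∧ (∀ x, V (x, 0) = 0) ∧ (∀ x, V (x, 1) = 0) ∧
      (∀ p, fderiv ℝ U p (1, 0) + fderiv ℝ V p (0, 1) = hartleySum L S id f p) ∧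
      (∫ x in (0 : ℝ)..L, ∫ z in (0 : ℝ)..1, fderiv ℝ U (x, z) (0, 1) ^ 2) ≤
        1.08 * D ^ 2 * H ^ 2 *
          ∫ x in (0 : ℝ)..L, ∫ z in (0 : ℝ)..1, hartleySum L S id f (x, z) ^ 2 ∧
      (∫ x in (0 : ℝ)..L, ∫ z in (0 : ℝ)..1, fderiv ℝ U (x, z) (1, 0) ^ 2) ≤
        2.6 * ∫ x in (0 : ℝ)..L, ∫ z in (0 : ℝ)..1, hartleySum L S id f (x, z) ^ 2 ∧
      (∫ x in (0 : ℝ)..L, ∫ z in (0 : ℝ)..1, fderiv ℝ V (x, z) (0, 1) ^ 2) ≤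
        2.6 * ∫ x in (0 : ℝ)..L, ∫ z in (0 : ℝ)..1, hartleySum L S id f (x, z) ^ 2 ∧
      H ^ 2 * (∫ x in (0 : ℝ)..L, ∫ z in (0 : ℝ)..1, fderiv ℝ V (x, z) (1, 0) ^ 2) ≤
        1.02 * ∫ x in (0 : ℝ)..L, ∫ z in (0 : ℝ)..1, hartleySum L S id f (x, z) ^ 2 := by
  have hk : ∀ n, waveNumber L n ≠ 0 → 6 ≤ |waveNumber L n| * H * D := by
    intro n hn
    have hn0 : n ≠ 0 := by rintro rfl; simp [waveNumber] at hn
    have h1 : (1 : ℝ) ≤ |(n : ℝ)| := by exact_mod_cast Int.one_le_abs hn0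
    have h2 : |waveNumber L n| = 2 * Real.pi * |(n : ℝ)| / L := by
      simp [waveNumber, abs_mul, abs_div, abs_of_pos Real.pi_pos, abs_of_pos hL]
    calc (6 : ℝ) ≤ 2 * Real.pi * 1 := by linarith [Real.pi_gt_three]
      _ ≤ 2 * Real.pi * |(n : ℝ)| := by gcongr
      _ = |waveNumber L n| * H * (L / H) := by rw [h2]; field_simp
      _ ≤ _ := by gcongr
  have h0 : ∀ n, waveNumber L n = 0 → ∫ z in (0 : ℝ)..1, f n z = 0 := by
    intro n hn
    by_cases h : n = 0
    · rw [h, hf0]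
    · exact absurd hn (waveNumber_ne_zero hL.ne' h)
  choose a b ca cb a0 a1 b0 b1 he e1 e2 e3 e4 using
    fun n => exists_mode hH hD (hk n) (hf n) (h0 n)
  have cda : ∀ n, Continuous (deriv (a n)) := fun n => (ca n).continuous_deriv le_rfl
  have cdb : ∀ n, Continuous (deriv (b n)) := fun n => (cb n).continuous_deriv le_rfl
  have cca : ∀ n, Continuous (a n) := fun n => (ca n).continuous
  have ccb : ∀ n, Continuous (b n) := fun n => (cb n).continuous
  have ineg : Function.Injective fun n : ℤ => -n := neg_injective
  have hnn : (fun n : ℤ => - -n) = id := funext neg_neg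
  have hcm : ∀ (c : ℝ) (g : ℝ → ℝ), (∫ z in (0 : ℝ)..1, (c * g z) ^ 2) =
      c ^ 2 * ∫ z in (0 : ℝ)..1, g z ^ 2 := by
    intro c g
    simp_rw [mul_pow]
    rw [intervalIntegral.integral_const_mul]
  refine ⟨hartleySum L S (fun n => -n) a, hartleySum L S id b, contDiff_hartleySum _ _ _ ca,
    contDiff_hartleySum _ _ _ cb, hartleySum_add_period hL.ne' _ _ _,
    hartleySum_add_period hL.ne' _ _ _, by simp [hartleySum, a0], by simp [hartleySum, a1],
    by simp [hartleySum, b0], by simp [hartleySum, b1], ?_, ?_, ?_, ?_, ?_⟩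
  · intro p
    rw [fderiv_hartleySum_fst _ _ _ ca, fderiv_hartleySum_snd _ _ _ cb, hnn]
    simp only [hartleySum, ← Finset.sum_add_distrib]
    refine Finset.sum_congr rfl fun n _ => ?_
    rw [← he n, waveNumber_neg]
    ring
  all_goals simp only [fderiv_hartleySum_fst _ _ _ ca, fderiv_hartleySum_snd _ _ _ ca,
    fderiv_hartleySum_fst _ _ _ cb, fderiv_hartleySum_snd _ _ _ cb, hnn, id]
  all_goals rw [integral_hartleySum_sq hL.ne' S Function.injective_id hf]
  · rw [integral_hartleySum_sq hL.ne' S ineg cda, mul_left_comm]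
    refine mul_le_mul_of_nonneg_left ?_ hL.le
    rw [Finset.mul_sum]
    refine Finset.sum_le_sum fun n _ => ?_
    exact e1 n
  · rw [integral_hartleySum_sq hL.ne' S Function.injective_id (by fun_prop), mul_left_comm]
    refine mul_le_mul_of_nonneg_left ?_ hL.le
    rw [Finset.mul_sum]
    refine Finset.sum_le_sum fun n _ => ?_
    rw [hcm, waveNumber_neg, neg_sq]
    exact e2 n
  · rw [integral_hartleySum_sq hL.ne' S Function.injective_id cdb, mul_left_comm]
    refine mul_le_mul_of_nonneg_left ?_ hL.le
    rw [Finset.mul_sum]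
    refine Finset.sum_le_sum fun n _ => ?_
    exact e3 n
  · rw [integral_hartleySum_sq hL.ne' S ineg (by fun_prop), mul_left_comm, mul_left_comm 1.02]
    refine mul_le_mul_of_nonneg_left ?_ hL.le
    rw [Finset.mul_sum, Finset.mul_sum]
    refine Finset.sum_le_sum fun n _ => ?_
    rw [hcm]
    exact e4 n

theorem integral_id_mul_deriv_add_sq_le {g : ℝ → ℝ} (hg : ContDiff ℝ 1 g) (h1 : g 1 = 0) :
    ∫ z in (0 : ℝ)..1, (g z + z * deriv g z) ^ 2 ≤ ∫ z in (0 : ℝ)..1, deriv g z ^ 2 := by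
  have hc := hg.continuous
  have hd := hg.continuous_deriv le_rfl
  have hD : ∀ z, HasDerivAt (fun z => z * g z ^ 2) (g z ^ 2 + 2 * z * g z * deriv g z) z := by
    intro z
    have h := (hg.differentiable one_ne_zero z).hasDerivAt
    refine ((hasDerivAt_id z).mul (h.pow 2)).congr_deriv ?_
    simp
    ring
  have h0 : ∫ z in (0 : ℝ)..1, (g z ^ 2 + 2 * z * g z * deriv g z) = 0 := by
    rw [intervalIntegral.integral_eq_sub_of_hasDerivAt (fun z _ => hD z)
      (Continuous.intervalIntegrable (by fun_prop) _ _)]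
    simp [h1]
  calc ∫ z in (0 : ℝ)..1, (g z + z * deriv g z) ^ 2
      = ∫ z in (0 : ℝ)..1, ((z * deriv g z) ^ 2 + (g z ^ 2 + 2 * z * g z * deriv g z)) := by
        congr 1; ext z; ring
    _ = ∫ z in (0 : ℝ)..1, (z * deriv g z) ^ 2 := by
        rw [intervalIntegral.integral_add (Continuous.intervalIntegrable (by fun_prop) _ _)
          (Continuous.intervalIntegrable (by fun_prop) _ _), h0, add_zero]
    _ ≤ _ := by
        refine intervalIntegral.integral_mono_on zero_le_one
          (Continuous.intervalIntegrable (by fun_prop) _ _)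
          (Continuous.intervalIntegrable (by fun_prop) _ _) fun z hz => ?_
        rw [mul_pow]
        exact mul_le_of_le_one_left (sq_nonneg _) (pow_le_one₀ hz.1 hz.2)

theorem integral_two_id_mul_add_sq_le {g : ℝ → ℝ} (hg : ContDiff ℝ 1 g) (h1 : g 1 = 0) :
    ∫ z in (0 : ℝ)..1, (2 * z * g z + z ^ 2 * deriv g z) ^ 2 ≤
      ∫ z in (0 : ℝ)..1, deriv g z ^ 2 := by
  have hc := hg.continuous
  have hd := hg.continuous_deriv le_rfl
  have hD : ∀ z, HasDerivAt (fun z => 2 * z ^ 3 * g z ^ 2)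
      (6 * z ^ 2 * g z ^ 2 + 4 * z ^ 3 * g z * deriv g z) z := by
    intro z
    have h := (hg.differentiable one_ne_zero z).hasDerivAt
    refine ((((hasDerivAt_id z).pow 3).const_mul 2).mul (h.pow 2)).congr_deriv ?_
    simp
    ring
  have h0 : ∫ z in (0 : ℝ)..1, (6 * z ^ 2 * g z ^ 2 + 4 * z ^ 3 * g z * deriv g z) = 0 := by
    rw [intervalIntegral.integral_eq_sub_of_hasDerivAt (fun z _ => hD z)
      (Continuous.intervalIntegrable (by fun_prop) _ _)]
    simp [h1]
  calc ∫ z in (0 : ℝ)..1, (2 * z * g z + z ^ 2 * deriv g z) ^ 2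
      = ∫ z in (0 : ℝ)..1, (((z ^ 2 * deriv g z) ^ 2 - 2 * (z * g z) ^ 2) +
          (6 * z ^ 2 * g z ^ 2 + 4 * z ^ 3 * g z * deriv g z)) := by
        congr 1; ext z; ring
    _ = ∫ z in (0 : ℝ)..1, ((z ^ 2 * deriv g z) ^ 2 - 2 * (z * g z) ^ 2) := by
        rw [intervalIntegral.integral_add (Continuous.intervalIntegrable (by fun_prop) _ _)
          (Continuous.intervalIntegrable (by fun_prop) _ _), h0, add_zero]
    _ ≤ _ := by
        refine intervalIntegral.integral_mono_on zero_le_one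
          (Continuous.intervalIntegrable (by fun_prop) _ _)
          (Continuous.intervalIntegrable (by fun_prop) _ _) fun z hz => ?_
        have : (z ^ 2 * deriv g z) ^ 2 ≤ deriv g z ^ 2 := by
          rw [mul_pow]
          exact mul_le_of_le_one_left (sq_nonneg _)
            (pow_le_one₀ (sq_nonneg z) (pow_le_one₀ hz.1 hz.2))
        nlinarith [sq_nonneg (z * g z)]

theorem sq_integral_le {f : ℝ → ℝ} (hf : Continuous f) {a b : ℝ} (hab : a ≤ b) :
    (∫ z in a..b, f z) ^ 2 ≤ (b - a) * ∫ z in a..b, f z ^ 2 := by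
  rcases hab.eq_or_lt with rfl | hlt
  · simp
  set I := ∫ z in a..b, f z with hI
  have h0 : 0 ≤ ∫ z in a..b, ((b - a) * f z - I) ^ 2 :=
    intervalIntegral.integral_nonneg hab fun z _ => sq_nonneg _
  have h1 : ∫ z in a..b, ((b - a) * f z - I) ^ 2 =
      (b - a) * ((b - a) * (∫ z in a..b, f z ^ 2) - I ^ 2) := by
    have : ∀ z, ((b - a) * f z - I) ^ 2 = (b - a) ^ 2 * f z ^ 2 - 2 * (b - a) * I * f z + I ^ 2 :=
      fun z => by ring
    simp_rw [this]
    rw [intervalIntegral.integral_add (Continuous.intervalIntegrable (by fun_prop) _ _)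
      (Continuous.intervalIntegrable (by fun_prop) _ _),
      intervalIntegral.integral_sub (Continuous.intervalIntegrable (by fun_prop) _ _)
      (Continuous.intervalIntegrable (by fun_prop) _ _), intervalIntegral.integral_const_mul,
      intervalIntegral.integral_const_mul, ← hI, intervalIntegral.integral_const, smul_eq_mul]
    ring
  rw [h1] at h0
  have := nonneg_of_mul_nonneg_right h0 (sub_pos.2 hlt)
  linarith

theorem integral_id_mul_sq_le {g : ℝ → ℝ} (hg : ContDiff ℝ 1 g) (h1 : g 1 = 0) :
    12 * ∫ z in (0 : ℝ)..1, (z * g z) ^ 2 ≤ ∫ z in (0 : ℝ)..1, deriv g z ^ 2 := by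
  have hc := hg.continuous
  have hd := hg.continuous_deriv le_rfl
  set I := ∫ z in (0 : ℝ)..1, deriv g z ^ 2 with hI
  have hb : ∀ z ∈ Icc (0 : ℝ) 1, (z * g z) ^ 2 ≤ (z ^ 2 - z ^ 3) * I := by
    intro z hz
    have e1 : ∫ t in z..1, deriv g t = -g z := by
      rw [intervalIntegral.integral_eq_sub_of_hasDerivAt
        (fun t _ => (hg.differentiable one_ne_zero t).hasDerivAt) (hd.intervalIntegrable _ _), h1,
        zero_sub]
    have e2 := sq_integral_le hd hz.2
    rw [e1, neg_sq] at e2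
    have e3 : ∫ t in z..1, deriv g t ^ 2 ≤ I := by
      refine intervalIntegral.integral_mono_interval hz.1 hz.2 le_rfl
        (Filter.Eventually.of_forall fun t => sq_nonneg _)
        (Continuous.intervalIntegrable (by fun_prop) _ _)
    have e4 : (1 - z) * (∫ t in z..1, deriv g t ^ 2) ≤ (1 - z) * I :=
      mul_le_mul_of_nonneg_left e3 (by linarith [hz.2])
    rw [mul_pow]
    calc z ^ 2 * g z ^ 2 ≤ z ^ 2 * ((1 - z) * I) := by gcongr; linarith
      _ = _ := by ring
  have := intervalIntegral.integral_mono_on (μ := volume) (zero_le_one' ℝ)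
    (Continuous.intervalIntegrable (by fun_prop) _ _)
    (Continuous.intervalIntegrable (by fun_prop) _ _) hb
  rw [intervalIntegral.integral_mul_const, intervalIntegral.integral_sub
    (Continuous.intervalIntegrable (by fun_prop) _ _)
    (Continuous.intervalIntegrable (by fun_prop) _ _), integral_pow, integral_pow] at this
  norm_num at this
  linarith

/-- `2|s|ab ≤ (1 + m)/2 · (τ a² + b²/τ)` in polynomial form. -/
theorem two_mul_le_weighted {s m a b τ : ℝ} (hs : s ^ 2 ≤ m) (hτ : 0 < τ) (ha : 0 ≤ a)
    (hb : 0 ≤ b) : 2 * |s| * (a * b) ≤ (1 + m) / 2 * (τ * a ^ 2 + b ^ 2 / τ) := by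
  have h1 : 2 * |s| ≤ 1 + m := by nlinarith [sq_nonneg (|s| - 1), sq_abs s]
  have h2 : 2 * (a * b) ≤ τ * a ^ 2 + b ^ 2 / τ := by
    have : 0 ≤ (τ * a - b) ^ 2 / τ := by positivity
    have e : (τ * a - b) ^ 2 / τ = τ * a ^ 2 + b ^ 2 / τ - 2 * (a * b) := by
      field_simp; ring
    linarith
  have h3 : 0 ≤ 1 + m := by nlinarith [sq_nonneg s]
  calc 2 * |s| * (a * b) ≤ (1 + m) * (a * b) := by gcongr
    _ = (1 + m) / 2 * (2 * (a * b)) := by ring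
    _ ≤ _ := by gcongr

theorem sub_mul_sq_le {s m A P : ℝ} (hs : s ^ 2 ≤ m) :
    (A - s * P) ^ 2 ≤ (9 / 4 + 5 / 4 * m) * A ^ 2 + (1 / 5 + 6 / 5 * m) * P ^ 2 := by
  have h := two_mul_le_weighted hs (by norm_num : (0 : ℝ) < 5 / 2) (abs_nonneg A) (abs_nonneg P)
  have h1 : -(2 * s * (A * P)) ≤ 2 * |s| * (|A| * |P|) := by
    rw [← abs_mul, mul_assoc, mul_assoc, ← abs_mul]
    linarith [neg_abs_le (s * (A * P))]
  have h2 : s ^ 2 * P ^ 2 ≤ m * P ^ 2 := by gcongr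
  rw [sq_abs, sq_abs] at h
  linarith

theorem add_add_sq_le {s m a b c : ℝ} (hs : s ^ 2 ≤ m) (ha : 0 ≤ a) (hb : 0 ≤ b) (hc : 0 ≤ c) :
    (a + |s| * b + m * c) ^ 2 ≤ (9 / 5 + 19 / 5 * m) * a ^ 2 + (5 / 16 + 37 / 16 * m + m ^ 2) * b ^ 2 +
      (5 / 4 * m ^ 2 + 7 / 12 * m) * c ^ 2 := by
  have hm : 0 ≤ m := (sq_nonneg s).trans hs
  have h1 := two_mul_le_weighted hs (by norm_num : (0 : ℝ) < 8 / 5) ha hb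
  have h2 := mul_le_mul_of_nonneg_left
    (two_mul_le_weighted hs (by norm_num : (0 : ℝ) < 2) hb hc) hm
  have h3 : 0 ≤ m * (3 * a - c) ^ 2 := by positivity
  have h4 : s ^ 2 * b ^ 2 ≤ m * b ^ 2 := by gcongr
  have h5 : (|s| * b) ^ 2 = s ^ 2 * b ^ 2 := by rw [mul_pow, sq_abs]
  linarith

theorem pullback_shear_sq_le {h₀ h₁ h s b m ζ A C W Z Q : ℝ} (hh₀ : 0 < h₀) (hlow : h₀ ≤ h)
    (hhigh : h ≤ h₁) (hs : s ^ 2 ≤ m) (hb : |1 / 2 * h * b| ≤ m) (hζ0 : 0 ≤ ζ) (hζ1 : ζ ≤ 1) :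
    h₀ * h * (W - ζ * (s / h) * C + b * Z / h + ζ * s * A / h - s ^ 2 * Q / h ^ 2) ^ 2 ≤
      (9 / 5 + 19 / 5 * m) * (h₁ / h₀ * (h₀ * W) ^ 2) +
        (5 / 16 + 37 / 16 * m + m ^ 2) * (2 * A ^ 2 + 2 * C ^ 2) +
        (5 / 4 * m ^ 2 + 7 / 12 * m) * ((12 * Z ^ 2 + 3 / 2 * Q ^ 2) / h₀ ^ 2) := by
  have hh : 0 < h := hh₀.trans_le hlow
  have hm : 0 ≤ m := (sq_nonneg s).trans hs
  set X := W - ζ * (s / h) * C + b * Z / h + ζ * s * A / h - s ^ 2 * Q / h ^ 2 with hX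
  set w := √(h₀ * h) with hw
  have hw0 : 0 ≤ w := Real.sqrt_nonneg _
  have hw2 : w ^ 2 = h₀ * h := Real.sq_sqrt (by positivity)
  have hwh : w ≤ h := by
    rw [hw, Real.sqrt_le_left hh.le, sq]; gcongr
  have hwh' : w / h ≤ 1 := (div_le_one hh).2 hwh
  have hwh2 : w / h ^ 2 ≤ 1 / h₀ := by
    calc w / h ^ 2 = w / h * (1 / h) := by field_simp
      _ ≤ 1 * (1 / h₀) := by gcongr
      _ = _ := one_mul _
  have hbb : |b| * h ≤ 2 * m := by
    rw [abs_mul, abs_mul, abs_of_pos hh, abs_of_pos (by norm_num : (0 : ℝ) < 1 / 2)] at hb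
    linarith
  have hbm : w * (|b| * |Z| / h) ≤ 2 * m * |Z| / h₀ := by
    calc w * (|b| * |Z| / h) = |b| * h * |Z| * (w / h ^ 2) := by field_simp
      _ ≤ 2 * m * |Z| * (1 / h₀) := by gcongr
      _ = _ := by ring
  have hqm : w * (s ^ 2 * |Q| / h ^ 2) ≤ m * |Q| / h₀ := by
    calc w * (s ^ 2 * |Q| / h ^ 2) = s ^ 2 * |Q| * (w / h ^ 2) := by field_simp
      _ ≤ m * |Q| * (1 / h₀) := by gcongr
      _ = _ := by ring
  have hac : w * |ζ * (s / h) * (C - A)| ≤ |s| * |C - A| := by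
    rw [abs_mul, abs_mul, abs_div, abs_of_nonneg hζ0, abs_of_pos hh]
    calc w * (ζ * (|s| / h) * |C - A|) = ζ * (w / h) * (|s| * |C - A|) := by field_simp
      _ ≤ 1 * 1 * (|s| * |C - A|) := by gcongr
      _ = _ := by ring
  have hXe : X = W - ζ * (s / h) * (C - A) + b * Z / h - s ^ 2 * Q / h ^ 2 := by rw [hX]; ring
  have hXa : w * |X| ≤ w * |W| + |s| * |C - A| + m * ((2 * |Z| + |Q|) / h₀) := by
    have t1 : |X| ≤ |W| + |ζ * (s / h) * (C - A)| + |b| * |Z| / h + s ^ 2 * |Q| / h ^ 2 := by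
      have e1 : |b * Z / h| = |b| * |Z| / h := by rw [abs_div, abs_mul, abs_of_pos hh]
      have e2 : |s ^ 2 * Q / h ^ 2| = s ^ 2 * |Q| / h ^ 2 := by
        rw [abs_div, abs_mul, abs_of_nonneg (sq_nonneg s), abs_of_nonneg (sq_nonneg h)]
      rw [hXe, ← e1, ← e2]
      refine (abs_sub _ _).trans (add_le_add_left ((abs_add_le _ _).trans
        (add_le_add_left (abs_sub _ _) _)) _)
    have e : m * ((2 * |Z| + |Q|) / h₀) = 2 * m * |Z| / h₀ + m * |Q| / h₀ := by ring
    have := mul_le_mul_of_nonneg_left t1 hw0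
    rw [mul_add, mul_add, mul_add] at this
    linarith
  have hm1 : 0 ≤ 5 / 16 + 37 / 16 * m + m ^ 2 := by positivity
  calc h₀ * h * X ^ 2 = (w * |X|) ^ 2 := by rw [mul_pow, hw2, sq_abs]
    _ ≤ (w * |W| + |s| * |C - A| + m * ((2 * |Z| + |Q|) / h₀)) ^ 2 := by gcongr
    _ ≤ _ := add_add_sq_le hs (by positivity) (by positivity) (by positivity)
    _ ≤ _ := by
      gcongr
      · rw [mul_pow, hw2, sq_abs, mul_pow]
        calc h₀ * h * W ^ 2 ≤ h₀ * h₁ * W ^ 2 := by gcongr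
          _ = _ := by field_simp
      · rw [sq_abs]
        nlinarith [sq_nonneg (A + C)]
      · rw [div_pow]
        gcongr
        nlinarith [sq_nonneg (4 * |Z| - |Q|), sq_abs Z, sq_abs Q]

/-- Pointwise bound for the energy density of the transformed velocity field. -/
theorem pullback_energy_le {h₀ h₁ h s b m ζ A B C W Z P Q : ℝ} (hh₀ : 0 < h₀) (hlow : h₀ ≤ h)
    (hhigh : h ≤ h₁) (hs : s ^ 2 ≤ m) (hb : |1 / 2 * h * b| ≤ m) (hζ0 : 0 ≤ ζ) (hζ1 : ζ ≤ 1) :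
    ((A - s / h * P) / h) ^ 2 + (B / h ^ 2) ^ 2 +
      ((W - ζ * (s / h) * C + b * Z / h + ζ * s * A / h - s ^ 2 * Q / h ^ 2) ^ 2 +
        ((C + s / h * P) / h) ^ 2) ≤
      ((23 / 8 + 47 / 8 * m + 2 * m ^ 2) * (A ^ 2 + C ^ 2) +
        ((2 / 5 + 12 / 5 * m) * P ^ 2 + B ^ 2 +
          (5 / 4 * m ^ 2 + 7 / 12 * m) * (12 * Z ^ 2 + 3 / 2 * Q ^ 2)) / h₀ ^ 2 +
        (9 / 5 + 19 / 5 * m) * (h₁ / h₀) * (h₀ ^ 2 * W ^ 2)) / h₀ / h := by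
  have hh : 0 < h := hh₀.trans_le hlow
  have hm : 0 ≤ m := (sq_nonneg s).trans hs
  have hP : (P / h) ^ 2 ≤ P ^ 2 / h₀ ^ 2 := by rw [div_pow]; gcongr
  have hr : h₀ / h ≤ 1 := (div_le_one hh).2 hlow
  have key : ∀ X s', s' ^ 2 ≤ m → h₀ * h * ((X - s' / h * P) / h) ^ 2 ≤
      (9 / 4 + 5 / 4 * m) * X ^ 2 + (1 / 5 + 6 / 5 * m) * (P ^ 2 / h₀ ^ 2) := by
    intro X s' hs'
    calc h₀ * h * ((X - s' / h * P) / h) ^ 2 = h₀ / h * (X - s' * (P / h)) ^ 2 := by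
          field_simp
      _ ≤ 1 * (X - s' * (P / h)) ^ 2 := by gcongr
      _ ≤ (9 / 4 + 5 / 4 * m) * X ^ 2 + (1 / 5 + 6 / 5 * m) * (P / h) ^ 2 := by
          rw [one_mul]; exact sub_mul_sq_le hs'
      _ ≤ _ := by gcongr
  have t1 := key A s hs
  have t3 := key C (-s) (by rwa [neg_sq])
  have t2 : h₀ * h * (B / h ^ 2) ^ 2 ≤ B ^ 2 / h₀ ^ 2 := by
    calc h₀ * h * (B / h ^ 2) ^ 2 = h₀ / h * (B ^ 2 / h ^ 2) := by field_simp
      _ ≤ 1 * (B ^ 2 / h₀ ^ 2) := by gcongr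
      _ = _ := one_mul _
  have t4 := pullback_shear_sq_le (A := A) (C := C) (W := W) (Z := Z) (Q := Q) hh₀ hlow hhigh hs hb
    hζ0 hζ1
  rw [neg_div, neg_mul, sub_neg_eq_add] at t3
  rw [div_div, le_div_iff₀ (by positivity), mul_comm]
  rw [mul_add, mul_add, mul_add]
  refine (add_le_add (add_le_add t1 t2) (add_le_add t4 t3)).trans (le_of_eq ?_)
  ring

theorem measurableSet_channelOmega (L : ℝ) {h : ℝ → ℝ} (hc : Continuous h) :
    MeasurableSet (ChannelOmega L h) :=
  measurableSet_regionBetween measurable_const hc.measurable measurableSet_Ioo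

theorem channelOmega_subset (L : ℝ) {h : ℝ → ℝ} {h₁ : ℝ} (hhigh : ∀ x, h x ≤ h₁) :
    ChannelOmega L h ⊆ Icc 0 L ×ˢ Icc 0 h₁ := fun _ hz =>
  ⟨Ioo_subset_Icc_self hz.1, hz.2.1.le, hz.2.2.le.trans (hhigh _)⟩

theorem integrableOn_channelOmega (L : ℝ) {h : ℝ → ℝ} {h₁ : ℝ} (hhigh : ∀ x, h x ≤ h₁)
    {G : ℝ × ℝ → ℝ} (hG : Continuous G) : IntegrableOn G (ChannelOmega L h) :=
  (hG.continuousOn.integrableOn_compact (isCompact_Icc.prod isCompact_Icc)).mono_set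
    (channelOmega_subset L hhigh)

theorem setIntegral_channelOmega {L : ℝ} (hL : 0 ≤ L) {h : ℝ → ℝ} (hc : Continuous h)
    (hpos : ∀ x, 0 < h x) {G : ℝ × ℝ → ℝ} (hG : IntegrableOn G (ChannelOmega L h)) :
    ∫ z in ChannelOmega L h, G z = ∫ x in (0 : ℝ)..L, ∫ y in (0 : ℝ)..h x, G (x, y) := by
  have hm := measurableSet_channelOmega L hc
  rw [← integral_indicator hm, Measure.volume_eq_prod, integral_prod _
    (by rw [← Measure.volume_eq_prod]; exact (integrable_indicator_iff hm).2 hG),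
    intervalIntegral.integral_of_le hL, integral_Ioc_eq_integral_Ioo,
    ← integral_indicator measurableSet_Ioo]
  congr 1
  ext x
  by_cases hx : x ∈ Ioo 0 L
  · rw [indicator_of_mem hx, intervalIntegral.integral_of_le (hpos x).le,
      integral_Ioc_eq_integral_Ioo, ← integral_indicator measurableSet_Ioo]
    congr 1
    ext y
    by_cases hy : y ∈ Ioo 0 (h x)
    · rw [indicator_of_mem hy, indicator_of_mem (show (x, y) ∈ ChannelOmega L h from ⟨hx, hy⟩)]
    · rw [indicator_of_notMem hy, indicator_of_notMem fun hxy => hy hxy.2]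
  · rw [indicator_of_notMem hx]
    have : ∀ y, (ChannelOmega L h).indicator G (x, y) = 0 := fun y =>
      indicator_of_notMem (fun hxy => hx hxy.1) _
    simp [this]

/-- The function on the channel obtained from a function on the strip of unit height. -/
noncomputable def stripPull (h : ℝ → ℝ) (U : ℝ × ℝ → ℝ) (p : ℝ × ℝ) : ℝ := U (p.1, p.2 / h p.1)

theorem continuous_stripPull {h : ℝ → ℝ} (hc : Continuous h) (hpos : ∀ x, 0 < h x)
    {U : ℝ × ℝ → ℝ} (hU : Continuous U) : Continuous (stripPull h U) :=
  hU.comp (continuous_fst.prodMk (continuous_snd.div (hc.comp continuous_fst)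
    fun p => (hpos p.1).ne'))

theorem contDiff_stripPull {h : ℝ → ℝ} (hc : ContDiff ℝ 1 h) (hpos : ∀ x, 0 < h x)
    {U : ℝ × ℝ → ℝ} (hU : ContDiff ℝ 1 U) : ContDiff ℝ 1 (stripPull h U) :=
  hU.comp (contDiff_fst.prodMk (contDiff_snd.div (hc.comp contDiff_fst)
    fun p => (hpos p.1).ne'))

theorem setIntegral_stripPull_div {L : ℝ} (hL : 0 ≤ L) {h : ℝ → ℝ} {h₁ : ℝ} (hc : Continuous h)
    (hpos : ∀ x, 0 < h x) (hhigh : ∀ x, h x ≤ h₁) {G : ℝ × ℝ → ℝ} (hG : Continuous G) :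
    ∫ z in ChannelOmega L h, stripPull h G z / h z.1 =
      ∫ x in (0 : ℝ)..L, ∫ z in (0 : ℝ)..1, G (x, z) := by
  have hcont : Continuous fun z : ℝ × ℝ => stripPull h G z / h z.1 :=
    (continuous_stripPull hc hpos hG).div (hc.comp continuous_fst) fun p => (hpos p.1).ne'
  rw [setIntegral_channelOmega hL hc hpos (integrableOn_channelOmega L hhigh hcont)]
  refine intervalIntegral.integral_congr fun x _ => ?_
  have hx := (hpos x).ne'
  simp only [stripPull, intervalIntegral.integral_div]
  rw [intervalIntegral.integral_comp_div (fun t => G (x, t)) hx, zero_div, div_self hx, smul_eq_mul,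
    mul_div_cancel_left₀ _ hx]

theorem hasDerivAt_stripPull_fst {h : ℝ → ℝ} (hc : Differentiable ℝ h) (hpos : ∀ x, 0 < h x)
    {U : ℝ × ℝ → ℝ} (hU : Differentiable ℝ U) (x y : ℝ) :
    HasDerivAt (fun t => stripPull h U (t, y)) (stripPull h (fun p => fderiv ℝ U p (1, 0)) (x, y) -
      y * deriv h x / h x ^ 2 * stripPull h (fun p => fderiv ℝ U p (0, 1)) (x, y)) x := by
  have h1 : HasDerivAt (fun t => (t, y / h t)) ((1 : ℝ), -(y * deriv h x) / h x ^ 2) x := by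
    refine (hasDerivAt_id x).prodMk ?_
    refine ((hasDerivAt_const x y).div (hc x).hasDerivAt (hpos x).ne').congr_deriv ?_
    simp
  refine ((hU (x, y / h x)).hasFDerivAt.comp_hasDerivAt x h1).congr_deriv ?_
  have : ((1 : ℝ), -(y * deriv h x) / h x ^ 2) =
      ((1 : ℝ), (0 : ℝ)) + (-(y * deriv h x) / h x ^ 2) • ((0 : ℝ), (1 : ℝ)) := by simp
  rw [this, map_add, map_smul, smul_eq_mul]
  simp only [stripPull]
  ring

theorem hasDerivAt_stripPull_snd (h : ℝ → ℝ) {U : ℝ × ℝ → ℝ} (hU : Differentiable ℝ U)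
    (x y : ℝ) : HasDerivAt (fun t => stripPull h U (x, t))
      (stripPull h (fun p => fderiv ℝ U p (0, 1)) (x, y) / h x) y := by
  have h1 : HasDerivAt (fun t => (x, t / h x)) ((0 : ℝ), 1 / h x) y :=
    (hasDerivAt_const y x).prodMk ((hasDerivAt_id y).div_const _)
  refine ((hU (x, y / h x)).hasFDerivAt.comp_hasDerivAt y h1).congr_deriv ?_
  have : ((0 : ℝ), 1 / h x) = (1 / h x) • ((0 : ℝ), (1 : ℝ)) := by simp
  rw [this, map_smul, smul_eq_mul]
  simp only [stripPull]
  ring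

theorem tendsto_setIntegral_comp {Ω κ : Set (ℝ × ℝ)} (hΩ : MeasurableSet Ω) (hκ : IsCompact κ)
    (hsub : Ω ⊆ κ) {Φ : ℝ × ℝ × ℝ × ℝ → ℝ} (hΦ : Continuous Φ) {a b : ℕ → ℝ → ℝ}
    {a' b' : ℝ → ℝ} {R : ℝ} (ha : ∀ j, Continuous (a j)) (hb : ∀ j, Continuous (b j))
    (haR : ∀ j x, |a j x| ≤ R) (hbR : ∀ j x, |b j x| ≤ R)
    (hlim : ∀ᵐ x, Filter.Tendsto (fun j => (a j x, b j x)) Filter.atTop (nhds (a' x, b' x)))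
    {g : ℝ × ℝ → ℝ} (hg : IntegrableOn g Ω) :
    Filter.Tendsto (fun j => ∫ z in Ω, g z * Φ (a j z.1, b j z.1, z)) Filter.atTop
      (nhds (∫ z in Ω, g z * Φ (a' z.1, b' z.1, z))) := by
  obtain ⟨B, hB⟩ := ((isCompact_Icc (a := -R) (b := R)).prod
    ((isCompact_Icc (a := -R) (b := R)).prod hκ)).exists_bound_of_continuousOn hΦ.continuousOn
  refine tendsto_integral_of_dominated_convergence (fun z => ‖g z‖ * B) ?_ (hg.norm.mul_const B)
    ?_ ?_
  · intro j
    refine hg.aestronglyMeasurable.mul (Continuous.aestronglyMeasurable ?_)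
    have := ha j
    have := hb j
    fun_prop
  · intro j
    filter_upwards [ae_restrict_mem hΩ] with z hz
    rw [norm_mul]
    gcongr
    exact hB _ ⟨abs_le.1 (haR j z.1), abs_le.1 (hbR j z.1), hsub hz⟩
  · refine ae_restrict_of_ae ?_
    have hq : Measure.QuasiMeasurePreserving (Prod.fst : ℝ × ℝ → ℝ) volume volume :=
      Measure.quasiMeasurePreserving_fst
    filter_upwards [hq.ae hlim] with z hz
    refine Filter.Tendsto.const_mul _ ((hΦ.tendsto _).comp ?_)
    have h1 := (continuous_fst.tendsto _).comp hz
    have h2 := (continuous_snd.tendsto _).comp hz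
    exact h1.prodMk_nhds (h2.prodMk_nhds tendsto_const_nhds)

/-- Difference quotients of the height function. -/
noncomputable def diffQuot (h : ℝ → ℝ) (j : ℕ) (x : ℝ) : ℝ :=
  ((j : ℝ) + 1) * (h (x + 1 / ((j : ℝ) + 1)) - h x)

theorem tendsto_diffQuot {h : ℝ → ℝ} {d x : ℝ} (hd : HasDerivAt h d x) :
    Filter.Tendsto (fun j => diffQuot h j x) Filter.atTop (nhds d) := by
  have h1 := hd.tendsto_slope_zero_right
  have h2 : Filter.Tendsto (fun j : ℕ => 1 / ((j : ℝ) + 1)) Filter.atTop (nhdsWithin 0 (Ioi 0)) :=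
    tendsto_nhdsWithin_iff.2 ⟨tendsto_one_div_add_atTop_nhds_zero_nat,
      Filter.Eventually.of_forall fun j => by simp only [mem_Ioi]; positivity⟩
  refine (h1.comp h2).congr fun j => ?_
  simp [diffQuot]

theorem abs_diffQuot_le {h : ℝ → ℝ} {K : NNReal} (hK : LipschitzWith K h) (j : ℕ) (x : ℝ) :
    |diffQuot h j x| ≤ K := by
  have hj : (0 : ℝ) < (j : ℝ) + 1 := by positivity
  have h1 := hK.dist_le_mul (x + 1 / ((j : ℝ) + 1)) x
  rw [Real.dist_eq, Real.dist_eq, add_sub_cancel_left,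
    abs_of_pos (by positivity : 0 < 1 / ((j : ℝ) + 1))] at h1
  rw [diffQuot, abs_mul, abs_of_pos hj]
  calc _ ≤ ((j : ℝ) + 1) * (K * (1 / ((j : ℝ) + 1))) := by gcongr
    _ = K := by field_simp

theorem hasDerivAt_diffQuot {h : ℝ → ℝ} (hd : Differentiable ℝ h) (j : ℕ) (x : ℝ) :
    HasDerivAt (diffQuot h j) (diffQuot (deriv h) j x) x := by
  have h1 := (hd (x + 1 / ((j : ℝ) + 1))).hasDerivAt.comp_add_const x (1 / ((j : ℝ) + 1))
  exact (h1.sub (hd x).hasDerivAt).const_mul _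

theorem contDiff_diffQuot {h : ℝ → ℝ} (hd : ContDiff ℝ 1 h) (j : ℕ) :
    ContDiff ℝ 1 (diffQuot h j) := by
  unfold diffQuot
  fun_prop

theorem continuous_diffQuot {h : ℝ → ℝ} (hd : Continuous h) (j : ℕ) :
    Continuous (diffQuot h j) := by
  unfold diffQuot
  fun_prop

/-- The integral over the flat strip `(0, L) × (0, 1)`. -/
noncomputable def stripIntegral (L : ℝ) (f : ℝ × ℝ → ℝ) : ℝ :=
  ∫ x in (0 : ℝ)..L, ∫ z in (0 : ℝ)..1, f (x, z)

theorem continuous_stripIntegral_inner {f : ℝ × ℝ → ℝ} (hf : Continuous f) :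
    Continuous fun x => ∫ z in (0 : ℝ)..1, f (x, z) :=
  intervalIntegral.continuous_parametric_intervalIntegral_of_continuous' (f := fun x z => f (x, z))
    hf 0 1

theorem stripIntegral_add (L : ℝ) {f g : ℝ × ℝ → ℝ} (hf : Continuous f) (hg : Continuous g) :
    stripIntegral L (fun p => f p + g p) = stripIntegral L f + stripIntegral L g := by
  unfold stripIntegral
  rw [← intervalIntegral.integral_add ((continuous_stripIntegral_inner hf).intervalIntegrable _ _)
    ((continuous_stripIntegral_inner hg).intervalIntegrable _ _)]
  refine intervalIntegral.integral_congr fun x _ => ?_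
  exact intervalIntegral.integral_add (Continuous.intervalIntegrable (by fun_prop) _ _)
    (Continuous.intervalIntegrable (by fun_prop) _ _)

theorem stripIntegral_const_mul (L c : ℝ) (f : ℝ × ℝ → ℝ) :
    stripIntegral L (fun p => c * f p) = c * stripIntegral L f := by
  simp [stripIntegral]

theorem stripIntegral_nonneg {L : ℝ} (hL : 0 ≤ L) {f : ℝ × ℝ → ℝ} (hf : ∀ p, 0 ≤ f p) :
    0 ≤ stripIntegral L f :=
  intervalIntegral.integral_nonneg hL fun _ _ =>
    intervalIntegral.integral_nonneg zero_le_one fun _ _ => hf _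

theorem stripIntegral_mono {L : ℝ} (hL : 0 ≤ L) {f g : ℝ × ℝ → ℝ} (hf : Continuous f)
    (hg : Continuous g)
    (h : ∀ x, ∫ z in (0 : ℝ)..1, f (x, z) ≤ ∫ z in (0 : ℝ)..1, g (x, z)) :
    stripIntegral L f ≤ stripIntegral L g :=
  intervalIntegral.integral_mono_on hL ((continuous_stripIntegral_inner hf).intervalIntegrable _ _)
    ((continuous_stripIntegral_inner hg).intervalIntegrable _ _) fun x _ => h x

theorem continuous_fderiv_apply {U : ℝ × ℝ → ℝ} (hU : ContDiff ℝ 1 U) (w : ℝ × ℝ) :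
    Continuous fun p => fderiv ℝ U p w :=
  (hU.continuous_fderiv one_ne_zero).clm_apply continuous_const

theorem hasDerivAt_slice {U : ℝ × ℝ → ℝ} (hU : ContDiff ℝ 1 U) (x z : ℝ) :
    HasDerivAt (fun t => U (x, t)) (fderiv ℝ U (x, z) (0, 1)) z :=
  (hU.differentiable one_ne_zero (x, z)).hasFDerivAt.comp_hasDerivAt z
    ((hasDerivAt_const z x).prodMk (hasDerivAt_id z))

/-- Bounds, by the vertical energy, for the weighted norms of a field vanishing on the upper wall
of the strip. -/
theorem stripIntegral_weighted_le {L : ℝ} (hL : 0 ≤ L) {U : ℝ × ℝ → ℝ} (hU : ContDiff ℝ 1 U)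
    (hU1 : ∀ x, U (x, 1) = 0) :
    stripIntegral L (fun p => (U p + p.2 * fderiv ℝ U p (0, 1)) ^ 2) ≤
        stripIntegral L (fun p => fderiv ℝ U p (0, 1) ^ 2) ∧
      stripIntegral L (fun p => (2 * p.2 * U p + p.2 ^ 2 * fderiv ℝ U p (0, 1)) ^ 2) ≤
        stripIntegral L (fun p => fderiv ℝ U p (0, 1) ^ 2) ∧
      12 * stripIntegral L (fun p => (p.2 * U p) ^ 2) ≤
        stripIntegral L (fun p => fderiv ℝ U p (0, 1) ^ 2) := by
  have c0 := hU.continuous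
  have c2 := continuous_fderiv_apply hU (0, 1)
  have hd : ∀ x z, deriv (fun t => U (x, t)) z = fderiv ℝ U (x, z) (0, 1) := fun x z =>
    (hasDerivAt_slice hU x z).deriv
  have hs : ∀ x, ContDiff ℝ 1 fun t => U (x, t) := fun x => by fun_prop
  refine ⟨stripIntegral_mono hL (by fun_prop) (by fun_prop) fun x => ?_,
    stripIntegral_mono hL (by fun_prop) (by fun_prop) fun x => ?_, ?_⟩
  · have := integral_id_mul_deriv_add_sq_le (hs x) (hU1 x)
    simpa only [hd] using this
  · have := integral_two_id_mul_add_sq_le (hs x) (hU1 x)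
    simpa only [hd] using this
  · rw [← stripIntegral_const_mul]
    refine stripIntegral_mono hL (by fun_prop) (by fun_prop) fun x => ?_
    have := integral_id_mul_sq_le (hs x) (hU1 x)
    simp only [hd] at this
    rwa [intervalIntegral.integral_const_mul]

/-- The quantity dominating, after rescaling, the energy density of the transformed field. -/
noncomputable def stripDensity (h₀ h₁ m : ℝ) (U V : ℝ × ℝ → ℝ) (p : ℝ × ℝ) : ℝ :=
  ((23 / 8 + 47 / 8 * m + 2 * m ^ 2) * (fderiv ℝ U p (1, 0) ^ 2 + fderiv ℝ V p (0, 1) ^ 2) +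
    ((2 / 5 + 12 / 5 * m) * (U p + p.2 * fderiv ℝ U p (0, 1)) ^ 2 + fderiv ℝ U p (0, 1) ^ 2 +
      (5 / 4 * m ^ 2 + 7 / 12 * m) * (12 * (p.2 * U p) ^ 2 +
        3 / 2 * (2 * p.2 * U p + p.2 ^ 2 * fderiv ℝ U p (0, 1)) ^ 2)) / h₀ ^ 2 +
    (9 / 5 + 19 / 5 * m) * (h₁ / h₀) * (h₀ ^ 2 * fderiv ℝ V p (1, 0) ^ 2)) / h₀

theorem continuous_stripDensity (h₀ h₁ m : ℝ) {U V : ℝ × ℝ → ℝ} (hU : ContDiff ℝ 1 U)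
    (hV : ContDiff ℝ 1 V) : Continuous (stripDensity h₀ h₁ m U V) := by
  have c0 := hU.continuous
  have c1 := continuous_fderiv_apply hU (1, 0)
  have c2 := continuous_fderiv_apply hU (0, 1)
  have c3 := continuous_fderiv_apply hV (1, 0)
  have c4 := continuous_fderiv_apply hV (0, 1)
  unfold stripDensity
  fun_prop

theorem stripIntegral_stripDensity_le {L h₀ h₁ m D J : ℝ} (hL : 0 ≤ L) (hh₀ : 0 < h₀)
    (hm : 0 ≤ m) (hD : 4 ≤ D) (hr : h₁ / h₀ ≤ D) (hJ : 0 ≤ J)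
    {U V : ℝ × ℝ → ℝ} (hU : ContDiff ℝ 1 U) (hV : ContDiff ℝ 1 V) (hU1 : ∀ x, U (x, 1) = 0)
    (e1 : stripIntegral L (fun p => fderiv ℝ U p (0, 1) ^ 2) ≤ 1.08 * D ^ 2 * h₀ ^ 2 * J)
    (e2 : stripIntegral L (fun p => fderiv ℝ U p (1, 0) ^ 2) ≤ 2.6 * J)
    (e3 : stripIntegral L (fun p => fderiv ℝ V p (0, 1) ^ 2) ≤ 2.6 * J)
    (e4 : h₀ ^ 2 * stripIntegral L (fun p => fderiv ℝ V p (1, 0) ^ 2) ≤ 1.02 * J) :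
    stripIntegral L (stripDensity h₀ h₁ m U V) ≤ ((9 / 4) * (1 + m) * D) ^ 2 * (J / h₀) := by
  have c0 := hU.continuous
  have c1 := continuous_fderiv_apply hU (1, 0)
  have c2 := continuous_fderiv_apply hU (0, 1)
  have c3 := continuous_fderiv_apply hV (1, 0)
  have c4 := continuous_fderiv_apply hV (0, 1)
  obtain ⟨w1, w2, w3⟩ := stripIntegral_weighted_le hL hU hU1
  have hexp : stripIntegral L (stripDensity h₀ h₁ m U V) =
      ((23 / 8 + 47 / 8 * m + 2 * m ^ 2) * (stripIntegral L (fun p => fderiv ℝ U p (1, 0) ^ 2) +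
          stripIntegral L (fun p => fderiv ℝ V p (0, 1) ^ 2)) +
        ((2 / 5 + 12 / 5 * m) *
            stripIntegral L (fun p => (U p + p.2 * fderiv ℝ U p (0, 1)) ^ 2) +
          stripIntegral L (fun p => fderiv ℝ U p (0, 1) ^ 2) +
          (5 / 4 * m ^ 2 + 7 / 12 * m) * (12 * stripIntegral L (fun p => (p.2 * U p) ^ 2) +
            3 / 2 * stripIntegral L
              (fun p => (2 * p.2 * U p + p.2 ^ 2 * fderiv ℝ U p (0, 1)) ^ 2))) / h₀ ^ 2 +
        (9 / 5 + 19 / 5 * m) * (h₁ / h₀) *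
          (h₀ ^ 2 * stripIntegral L (fun p => fderiv ℝ V p (1, 0) ^ 2))) / h₀ := by
    unfold stripDensity
    simp only [div_eq_inv_mul]
    rw [stripIntegral_const_mul, stripIntegral_add _ (by fun_prop) (by fun_prop),
      stripIntegral_add _ (by fun_prop) (by fun_prop), stripIntegral_const_mul,
      stripIntegral_const_mul, stripIntegral_const_mul, stripIntegral_const_mul,
      stripIntegral_add _ (by fun_prop) (by fun_prop),
      stripIntegral_add _ (by fun_prop) (by fun_prop),
      stripIntegral_add _ (by fun_prop) (by fun_prop), stripIntegral_const_mul,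
      stripIntegral_const_mul, stripIntegral_add _ (by fun_prop) (by fun_prop),
      stripIntegral_const_mul, stripIntegral_const_mul]
  rw [hexp, show (9 / 4 * (1 + m) * D) ^ 2 * (J / h₀) = (9 / 4 * (1 + m) * D) ^ 2 * J / h₀ by ring]
  refine div_le_div_of_nonneg_right ?_ hh₀.le
  set A := stripIntegral L (fun p => fderiv ℝ U p (1, 0) ^ 2)
  set B := stripIntegral L (fun p => fderiv ℝ U p (0, 1) ^ 2)
  set C := stripIntegral L (fun p => fderiv ℝ V p (0, 1) ^ 2)
  set W := stripIntegral L (fun p => fderiv ℝ V p (1, 0) ^ 2)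
  have hW : 0 ≤ h₀ ^ 2 * W := mul_nonneg (sq_nonneg _) (stripIntegral_nonneg hL fun _ => sq_nonneg _)
  clear_value A B C W
  generalize 12 * stripIntegral L (fun p => (p.2 * U p) ^ 2) = Z at w3 hexp ⊢
  have hX : 0 ≤ D ^ 2 * J := by positivity
  have hD16 : 16 * J ≤ D ^ 2 * J := by gcongr; nlinarith
  have hrD : h₁ / h₀ ≤ D ^ 2 / 4 := by nlinarith
  calc _ ≤ (23 / 8 + 47 / 8 * m + 2 * m ^ 2) * (2.6 * J + 2.6 * J) +
        ((2 / 5 + 12 / 5 * m) * (1.08 * D ^ 2 * h₀ ^ 2 * J) + 1.08 * D ^ 2 * h₀ ^ 2 * J +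
          (5 / 4 * m ^ 2 + 7 / 12 * m) * (1.08 * D ^ 2 * h₀ ^ 2 * J +
            3 / 2 * (1.08 * D ^ 2 * h₀ ^ 2 * J))) / h₀ ^ 2 +
        (9 / 5 + 19 / 5 * m) * (D ^ 2 / 4) * (1.02 * J) := by
        have w1' := w1.trans e1
        gcongr
        · exact w3.trans e1
        · exact w2.trans e1
    _ = 26 / 5 * (23 / 8 + 47 / 8 * m + 2 * m ^ 2) * J +
        27 / 25 * (7 / 5 + 12 / 5 * m + 5 / 2 * (5 / 4 * m ^ 2 + 7 / 12 * m)) * (D ^ 2 * J) +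
        51 / 200 * (9 / 5 + 19 / 5 * m) * (D ^ 2 * J) := by
        field_simp
        ring
    _ ≤ 26 / 5 * (23 / 8 + 47 / 8 * m + 2 * m ^ 2) * (D ^ 2 * J / 16) +
        27 / 25 * (7 / 5 + 12 / 5 * m + 5 / 2 * (5 / 4 * m ^ 2 + 7 / 12 * m)) * (D ^ 2 * J) +
        51 / 200 * (9 / 5 + 19 / 5 * m) * (D ^ 2 * J) := by
        gcongr
        linarith
    _ ≤ _ := by
        have k1 : 0 ≤ m * (D ^ 2 * J) := by positivity
        have k2 : 0 ≤ m ^ 2 * (D ^ 2 * J) := by positivity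
        nlinarith

theorem fderiv_stripPull_div {h : ℝ → ℝ} (hc : ContDiff ℝ 1 h) (hpos : ∀ x, 0 < h x)
    {U : ℝ × ℝ → ℝ} (hU : ContDiff ℝ 1 U) :
    ContDiff ℝ 1 (fun p : ℝ × ℝ => stripPull h U p / h p.1) ∧ ∀ z : ℝ × ℝ,
      fderiv ℝ (fun p : ℝ × ℝ => stripPull h U p / h p.1) z (1, 0) =
        (stripPull h (fun p => fderiv ℝ U p (1, 0)) z - deriv h z.1 / h z.1 *
          (stripPull h U z + z.2 / h z.1 * stripPull h (fun p => fderiv ℝ U p (0, 1)) z)) / h z.1 ∧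
      fderiv ℝ (fun p : ℝ × ℝ => stripPull h U p / h p.1) z (0, 1) =
        stripPull h (fun p => fderiv ℝ U p (0, 1)) z / h z.1 ^ 2 := by
  have hC : ContDiff ℝ 1 (fun p : ℝ × ℝ => stripPull h U p / h p.1) :=
    (contDiff_stripPull hc hpos hU).div (hc.comp contDiff_fst) fun p => (hpos p.1).ne'
  have hd := hc.differentiable one_ne_zero
  have hUd := hU.differentiable one_ne_zero
  refine ⟨hC, fun ⟨x, y⟩ => ⟨fderiv_fst_eq (hC.differentiable one_ne_zero _) ?_,
    fderiv_snd_eq (hC.differentiable one_ne_zero _) ?_⟩⟩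
  · have hx := (hpos x).ne'
    refine ((hasDerivAt_stripPull_fst hd hpos hUd x y).div (hd x).hasDerivAt hx).congr_deriv ?_
    field_simp
    ring
  · have hx := (hpos x).ne'
    refine ((hasDerivAt_stripPull_snd h hUd x y).div_const (h x)).congr_deriv ?_
    field_simp

theorem fderiv_stripPull_add_shear {h : ℝ → ℝ} (hc : ContDiff ℝ 1 h) (hpos : ∀ x, 0 < h x)
    {U V : ℝ × ℝ → ℝ} (hU : ContDiff ℝ 1 U) (hV : ContDiff ℝ 1 V) {θ θ' : ℝ → ℝ}
    (hθ : ContDiff ℝ 1 θ) (hθ' : ∀ x, HasDerivAt θ (θ' x) x) :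
    ContDiff ℝ 1 (fun p : ℝ × ℝ => stripPull h V p + p.2 * θ p.1 * stripPull h U p / h p.1 ^ 2) ∧
    ∀ z : ℝ × ℝ,
      fderiv ℝ (fun p : ℝ × ℝ => stripPull h V p + p.2 * θ p.1 * stripPull h U p / h p.1 ^ 2) z
          (1, 0) =
        stripPull h (fun p => fderiv ℝ V p (1, 0)) z -
          z.2 / h z.1 * (deriv h z.1 / h z.1) * stripPull h (fun p => fderiv ℝ V p (0, 1)) z +
          θ' z.1 * (z.2 / h z.1 * stripPull h U z) / h z.1 +
          z.2 / h z.1 * θ z.1 * stripPull h (fun p => fderiv ℝ U p (1, 0)) z / h z.1 -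
          θ z.1 * deriv h z.1 * (2 * (z.2 / h z.1) * stripPull h U z +
            (z.2 / h z.1) ^ 2 * stripPull h (fun p => fderiv ℝ U p (0, 1)) z) / h z.1 ^ 2 ∧
      fderiv ℝ (fun p : ℝ × ℝ => stripPull h V p + p.2 * θ p.1 * stripPull h U p / h p.1 ^ 2) z
          (0, 1) =
        (stripPull h (fun p => fderiv ℝ V p (0, 1)) z + θ z.1 / h z.1 *
          (stripPull h U z + z.2 / h z.1 * stripPull h (fun p => fderiv ℝ U p (0, 1)) z)) /
          h z.1 := by
  have hC : ContDiff ℝ 1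
      (fun p : ℝ × ℝ => stripPull h V p + p.2 * θ p.1 * stripPull h U p / h p.1 ^ 2) :=
    (contDiff_stripPull hc hpos hV).add (((contDiff_snd.mul (hθ.comp contDiff_fst)).mul
      (contDiff_stripPull hc hpos hU)).div ((hc.comp contDiff_fst).pow 2)
      fun p => (pow_pos (hpos p.1) 2).ne')
  have hd := hc.differentiable one_ne_zero
  have hUd := hU.differentiable one_ne_zero
  have hVd := hV.differentiable one_ne_zero
  refine ⟨hC, fun ⟨x, y⟩ => ⟨fderiv_fst_eq (hC.differentiable one_ne_zero _) ?_,
    fderiv_snd_eq (hC.differentiable one_ne_zero _) ?_⟩⟩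
  · have hx := (hpos x).ne'
    refine ((hasDerivAt_stripPull_fst hd hpos hVd x y).add ((((hθ' x).const_mul y).mul
      (hasDerivAt_stripPull_fst hd hpos hUd x y)).div ((hd x).hasDerivAt.pow 2)
      (pow_ne_zero 2 hx))).congr_deriv ?_
    simp only [Pi.mul_apply, Pi.pow_apply]
    push_cast
    field_simp
    ring
  · have hx := (hpos x).ne'
    refine ((hasDerivAt_stripPull_snd h hVd x y).add ((((hasDerivAt_id y).mul_const (θ x)).mul
      (hasDerivAt_stripPull_snd h hUd x y)).div_const (h x ^ 2))).congr_deriv ?_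
    simp only [id]
    field_simp

theorem contDiff_one_of_lipschitz_deriv {h : ℝ → ℝ} (hdiff : Differentiable ℝ h) {K : NNReal}
    (hlip : LipschitzWith K (deriv h)) : ContDiff ℝ 1 h :=
  contDiff_one_iff_deriv.2 ⟨hdiff, hlip.continuous⟩

/-- The pairing of the pressure gradient with the field obtained by transplanting a field `(U, V)`
from the strip to the channel. -/
theorem abs_pairing_le_of_strip_field {L h₀ h₁ M2 : ℝ} (hL : 0 < L) (hh₀ : 0 < h₀)
    {h : ℝ → ℝ} (hdiff : Differentiable ℝ h) {K : NNReal} (hlip : LipschitzWith K (deriv h))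
    (hperh : ∀ x, h (x + L) = h x) (hlow : ∀ x, h₀ ≤ h x) (hhigh : ∀ x, h x ≤ h₁)
    (hM1 : ∀ x, (deriv h x) ^ 2 ≤ M2) (hM2 : ∀ x, |(1 / 2) * h x * deriv (deriv h) x| ≤ M2)
    {p : ℝ × ℝ → ℝ} (hp1 : IntegrableOn p (ChannelOmega L h)) {N : ℝ} (hN0 : 0 ≤ N)
    (hN : ∀ u v : ℝ × ℝ → ℝ, AdmChannel L h u → AdmChannel L h v →
      |∫ z in ChannelOmega L h, p z * ((fderiv ℝ u z (1, 0)) + (fderiv ℝ v z (0, 1)))|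
        ≤ N * Real.sqrt (energyChannel L h u + energyChannel L h v))
    {U V : ℝ × ℝ → ℝ} (hU : ContDiff ℝ 1 U) (hV : ContDiff ℝ 1 V)
    (pU : ∀ x z, U (x + L, z) = U (x, z)) (pV : ∀ x z, V (x + L, z) = V (x, z))
    (U0 : ∀ x, U (x, 0) = 0) (U1 : ∀ x, U (x, 1) = 0) (V0 : ∀ x, V (x, 0) = 0)
    (V1 : ∀ x, V (x, 1) = 0) :
    |∫ z in ChannelOmega L h, p z *
        (stripPull h (fun p => fderiv ℝ U p (1, 0) + fderiv ℝ V p (0, 1)) z / h z.1)| ≤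
      N * √(stripIntegral L (stripDensity h₀ h₁ M2 U V)) := by
  have hpos : ∀ x, 0 < h x := fun x => hh₀.trans_le (hlow x)
  have hne : ∀ x, h x ≠ 0 := fun x => (hpos x).ne'
  have hc1 : ContDiff ℝ 1 h := contDiff_one_of_lipschitz_deriv hdiff hlip
  have hc := hc1.continuous
  have hds := hlip.continuous
  have hm : 0 ≤ M2 := (sq_nonneg _).trans (hM1 0)
  have hlip' : LipschitzWith (Real.toNNReal √M2) h := by
    refine lipschitzWith_of_nnnorm_deriv_le hdiff fun x => ?_
    rw [← NNReal.coe_le_coe, Real.coe_toNNReal _ (Real.sqrt_nonneg _)]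
    exact Real.abs_le_sqrt (hM1 x)
  have hΩ := measurableSet_channelOmega L hc
  obtain ⟨cu, du⟩ := fderiv_stripPull_div hc1 hpos hU
  have dv := fun j => fderiv_stripPull_add_shear hc1 hpos hU hV (contDiff_diffQuot hc1 j)
    (hasDerivAt_diffQuot hdiff j)
  set u : ℝ × ℝ → ℝ := fun p => stripPull h U p / h p.1 with hu
  set v : ℕ → ℝ × ℝ → ℝ := fun j p =>
    stripPull h V p + p.2 * diffQuot h j p.1 * stripPull h U p / h p.1 ^ 2 with hv
  have au : AdmChannel L h u := by
    refine ⟨cu, fun x y => ?_, fun x => ?_, fun x => ?_⟩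
    · simp [hu, stripPull, hperh, pU]
    · simp [hu, stripPull, U0]
    · simp [hu, stripPull, div_self (hne x), U1]
  have av : ∀ j, AdmChannel L h (v j) := by
    refine fun j => ⟨(dv j).1, fun x y => ?_, fun x => ?_, fun x => ?_⟩
    · have : x + L + 1 / ((j : ℝ) + 1) = x + 1 / ((j : ℝ) + 1) + L := by ring
      simp only [hv, stripPull, diffQuot, this, hperh, pU, pV]
    · simp [hv, stripPull, V0]
    · simp [hv, stripPull, div_self (hne x), U1, V1]
  have cU := continuous_stripPull hc hpos hU.continuous
  have cUx := continuous_stripPull hc hpos (continuous_fderiv_apply hU (1, 0))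
  have cUz := continuous_stripPull hc hpos (continuous_fderiv_apply hU (0, 1))
  have cVx := continuous_stripPull hc hpos (continuous_fderiv_apply hV (1, 0))
  have cVz := continuous_stripPull hc hpos (continuous_fderiv_apply hV (0, 1))
  set Us := stripPull h U
  set Ux := stripPull h (fun p => fderiv ℝ U p (1, 0)) with hUx
  set Uz := stripPull h (fun p => fderiv ℝ U p (0, 1))
  set Vx := stripPull h (fun p => fderiv ℝ V p (1, 0))
  set Vz := stripPull h (fun p => fderiv ℝ V p (0, 1)) with hVz
  set ux : ℝ × ℝ → ℝ := fun z => (Ux z - deriv h z.1 / h z.1 * (Us z + z.2 / h z.1 * Uz z)) / h z.1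
    with hux
  set uy : ℝ × ℝ → ℝ := fun z => Uz z / h z.1 ^ 2 with huy
  set vx : ℝ × ℝ × ℝ × ℝ → ℝ := fun w => Vx w.2.2 -
    w.2.2.2 / h w.2.2.1 * (deriv h w.2.2.1 / h w.2.2.1) * Vz w.2.2 +
    w.2.1 * (w.2.2.2 / h w.2.2.1 * Us w.2.2) / h w.2.2.1 +
    w.2.2.2 / h w.2.2.1 * w.1 * Ux w.2.2 / h w.2.2.1 -
    w.1 * deriv h w.2.2.1 * (2 * (w.2.2.2 / h w.2.2.1) * Us w.2.2 +
      (w.2.2.2 / h w.2.2.1) ^ 2 * Uz w.2.2) / h w.2.2.1 ^ 2 with hvx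
  set vy : ℝ × ℝ × ℝ × ℝ → ℝ := fun w => (Vz w.2.2 + w.1 / h w.2.2.1 *
    (Us w.2.2 + w.2.2.2 / h w.2.2.1 * Uz w.2.2)) / h w.2.2.1 with hvy
  have du' : ∀ z, fderiv ℝ u z (1, 0) = ux z ∧ fderiv ℝ u z (0, 1) = uy z := du
  have dv' : ∀ j z,
      fderiv ℝ (v j) z (1, 0) = vx (diffQuot h j z.1, diffQuot (deriv h) j z.1, z) ∧
      fderiv ℝ (v j) z (0, 1) = vy (diffQuot h j z.1, diffQuot (deriv h) j z.1, z) :=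
    fun j => (dv j).2
  have cv : ∀ j, ContDiff ℝ 1 (v j) := fun j => (dv j).1
  have cux : Continuous ux := by
    simp only [hux]; fun_prop (disch := simp [hne])
  have cuy : Continuous uy := by
    simp only [huy]; fun_prop (disch := simp [hne])
  have cvx : Continuous vx := by
    simp only [hvx]; fun_prop (disch := simp [hne])
  have cvy : Continuous vy := by
    simp only [hvy]; fun_prop (disch := simp [hne])
  have hlim : ∀ᵐ x, Filter.Tendsto (fun j => (diffQuot h j x, diffQuot (deriv h) j x)) Filter.atTop
      (nhds (deriv h x, deriv (deriv h) x)) := by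
    filter_upwards [hlip.ae_differentiableAt (μ := volume)] with x hx
    exact (tendsto_diffQuot (hdiff x).hasDerivAt).prodMk_nhds (tendsto_diffQuot hx.hasDerivAt)
  have lim : ∀ {Φ : ℝ × ℝ × ℝ × ℝ → ℝ}, Continuous Φ → ∀ {g : ℝ × ℝ → ℝ},
      IntegrableOn g (ChannelOmega L h) →
      Filter.Tendsto (fun j => ∫ z in ChannelOmega L h,
        g z * Φ (diffQuot h j z.1, diffQuot (deriv h) j z.1, z)) Filter.atTop
        (nhds (∫ z in ChannelOmega L h, g z * Φ (deriv h z.1, deriv (deriv h) z.1, z))) :=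
    fun hΦ _ hg => tendsto_setIntegral_comp hΩ (isCompact_Icc.prod isCompact_Icc)
      (channelOmega_subset L hhigh) hΦ (continuous_diffQuot hc) (continuous_diffQuot hds)
      (fun j x => (abs_diffQuot_le hlip' j x).trans (NNReal.coe_le_coe.2 (le_max_left _ K)))
      (fun j x => (abs_diffQuot_le hlip j x).trans (NNReal.coe_le_coe.2 (le_max_right _ K)))
      hlim hg
  have l1 := lim (Φ := fun w => ux w.2.2 + vy w) (by fun_prop) hp1
  have l2 := lim (Φ := fun w => ux w.2.2 ^ 2 + uy w.2.2 ^ 2 + (vx w ^ 2 + vy w ^ 2)) (by fun_prop)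
    (integrableOn_channelOmega L hhigh (continuous_const (y := (1 : ℝ))))
  have hE : ∀ j, energyChannel L h u + energyChannel L h (v j) = ∫ z in ChannelOmega L h,
      (fun _ => (1 : ℝ)) z * (fun w : ℝ × ℝ × ℝ × ℝ =>
        ux w.2.2 ^ 2 + uy w.2.2 ^ 2 + (vx w ^ 2 + vy w ^ 2))
          (diffQuot h j z.1, diffQuot (deriv h) j z.1, z) := by
    intro j
    have c1 := continuous_fderiv_apply cu (1, 0)
    have c2 := continuous_fderiv_apply cu (0, 1)
    have c3 := continuous_fderiv_apply (cv j) (1, 0)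
    have c4 := continuous_fderiv_apply (cv j) (0, 1)
    unfold energyChannel
    rw [← integral_add (integrableOn_channelOmega L hhigh (by fun_prop))
      (integrableOn_channelOmega L hhigh (by fun_prop))]
    refine integral_congr_ae (Filter.Eventually.of_forall fun z => ?_)
    simp only [one_mul, (du' z).1, (du' z).2, (dv' j z).1, (dv' j z).2]
  have hbound := le_of_tendsto_of_tendsto' l1.abs (l2.sqrt.const_mul N) fun j => by
    have := hN u (v j) au (av j)
    rw [hE j] at this
    refine le_trans (le_of_eq ?_) this
    congr 1
    refine integral_congr_ae (Filter.Eventually.of_forall fun z => ?_)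
    simp only [(du' z).1, (dv' j z).2]
  refine le_trans (le_of_eq ?_) (hbound.trans ?_)
  · congr 1
    refine integral_congr_ae (Filter.Eventually.of_forall fun z => ?_)
    have hz := hne z.1
    simp only [hux, hvy, hUx, hVz, stripPull]
    field_simp
    ring
  · have cG := continuous_stripDensity h₀ h₁ M2 hU hV
    have cGs := continuous_stripPull hc hpos cG
    have cGh : Continuous fun z => stripPull h (stripDensity h₀ h₁ M2 U V) z / h z.1 := by
      fun_prop (disch := simp [hne])
    rw [stripIntegral, ← setIntegral_stripPull_div hL.le hc hpos hhigh cG]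
    refine mul_le_mul_of_nonneg_left (Real.sqrt_le_sqrt ?_) hN0
    refine integral_mono_of_nonneg (Filter.Eventually.of_forall fun z => ?_)
      (integrableOn_channelOmega L hhigh cGh) ?_
    · simp only [Pi.zero_apply]
      positivity
    · filter_upwards [ae_restrict_mem hΩ] with z hz
      have hζ0 : 0 ≤ z.2 / h z.1 := div_nonneg hz.2.1.le (hpos _).le
      have hζ1 : z.2 / h z.1 ≤ 1 := (div_le_one (hpos _)).2 hz.2.2.le
      have := pullback_energy_le (A := Ux z) (B := Uz z) (C := Vz z) (W := Vx z)
        (Z := z.2 / h z.1 * Us z) (P := Us z + z.2 / h z.1 * Uz z)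
        (Q := 2 * (z.2 / h z.1) * Us z + (z.2 / h z.1) ^ 2 * Uz z) hh₀ (hlow z.1) (hhigh z.1)
        (hM1 z.1) (hM2 z.1) hζ0 hζ1
      simp only [one_mul, hux, huy, hvx, hvy]
      rw [sq (deriv h z.1)] at this
      exact this

theorem nonneg_of_energy_bound {L : ℝ} (hL : 0 < L) {h : ℝ → ℝ} {h₁ : ℝ} (hc : ContDiff ℝ 1 h)
    (hperh : ∀ x, h (x + L) = h x) (hpos : ∀ x, 0 < h x) (hhigh : ∀ x, h x ≤ h₁) {N : ℝ}
    (hN : ∀ u v : ℝ × ℝ → ℝ, AdmChannel L h u → AdmChannel L h v →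
      0 ≤ N * Real.sqrt (energyChannel L h u + energyChannel L h v)) : 0 ≤ N := by
  have hC : ContDiff ℝ 1 (fun p : ℝ × ℝ => p.2 * (h p.1 - p.2)) :=
    contDiff_snd.mul ((hc.comp contDiff_fst).sub contDiff_snd)
  have au : AdmChannel L h (fun p => p.2 * (h p.1 - p.2)) :=
    ⟨hC, by simp [hperh], by simp, by simp⟩
  have a0 : AdmChannel L h (fun _ => 0) := ⟨contDiff_const, by simp, by simp, by simp⟩
  have hE0 : energyChannel L h (fun _ => 0) = 0 := by simp [energyChannel]
  have c1 := continuous_fderiv_apply hC (1, 0)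
  have c2 := continuous_fderiv_apply hC (0, 1)
  have hy : ∀ z : ℝ × ℝ, fderiv ℝ (fun p : ℝ × ℝ => p.2 * (h p.1 - p.2)) z (0, 1) =
      h z.1 - 2 * z.2 := fun ⟨x, y⟩ => by
    refine fderiv_snd_eq (hC.differentiable one_ne_zero _)
      (((hasDerivAt_id y).mul ((hasDerivAt_id y).const_sub (h x))).congr_deriv ?_)
    simp
    ring
  have hE : 0 < energyChannel L h (fun p => p.2 * (h p.1 - p.2)) := by
    have hch := hc.continuous
    calc (0 : ℝ) < ∫ x in (0 : ℝ)..L, h x ^ 3 / 3 :=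
          intervalIntegral.intervalIntegral_pos_of_pos_on
            (Continuous.intervalIntegrable (by fun_prop) _ _)
            (fun x _ => by have := hpos x; positivity) hL
      _ = ∫ z in ChannelOmega L h, (h z.1 - 2 * z.2) ^ 2 := by
          rw [setIntegral_channelOmega hL.le hch hpos
            (integrableOn_channelOmega L hhigh (by fun_prop))]
          refine intervalIntegral.integral_congr fun x _ => ?_
          have hd : ∀ y, HasDerivAt (fun y => -(h x - 2 * y) ^ 3 / 6) ((h x - 2 * y) ^ 2) y := by
            intro y
            refine (((((hasDerivAt_id y).const_mul 2).const_sub (h x)).pow 3).neg.div_const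
              6).congr_deriv ?_
            simp
            ring
          simp only
          rw [intervalIntegral.integral_eq_sub_of_hasDerivAt (fun y _ => hd y)
            (Continuous.intervalIntegrable (by fun_prop) _ _)]
          ring
      _ ≤ _ := by
          refine integral_mono (integrableOn_channelOmega L hhigh (by fun_prop))
            (integrableOn_channelOmega L hhigh (by fun_prop)) fun z => ?_
          simp only [hy]
          linarith [sq_nonneg
            (fderiv ℝ (fun p : ℝ × ℝ => p.2 * (h p.1 - p.2)) z (1, 0))]
  have := hN _ _ au a0
  rw [hE0, add_zero] at this
  exact nonneg_of_mul_nonneg_left this (Real.sqrt_pos.2 hE)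

/-- The pairing of the pressure with a mean-free Hartley polynomial, up to the Jacobian. -/
theorem abs_pairing_hartleySum_le {L h₀ h₁ M2 : ℝ} (hL : 0 < L) (hh₀ : 0 < h₀)
    {h : ℝ → ℝ} (hdiff : Differentiable ℝ h) {K : NNReal} (hlip : LipschitzWith K (deriv h))
    (hperh : ∀ x, h (x + L) = h x) (hlow : ∀ x, h₀ ≤ h x) (hhigh : ∀ x, h x ≤ h₁)
    (hM1 : ∀ x, (deriv h x) ^ 2 ≤ M2) (hM2 : ∀ x, |(1 / 2) * h x * deriv (deriv h) x| ≤ M2)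
    {p : ℝ × ℝ → ℝ} (hp1 : IntegrableOn p (ChannelOmega L h)) {N : ℝ} (hN0 : 0 ≤ N)
    (hN : ∀ u v : ℝ × ℝ → ℝ, AdmChannel L h u → AdmChannel L h v →
      |∫ z in ChannelOmega L h, p z * ((fderiv ℝ u z (1, 0)) + (fderiv ℝ v z (0, 1)))|
        ≤ N * Real.sqrt (energyChannel L h u + energyChannel L h v))
    (S : Finset ℤ) {f : ℤ → ℝ → ℝ} (hf : ∀ n, Continuous (f n))
    (hf0 : ∫ z in (0 : ℝ)..1, f 0 z = 0) :
    |∫ z in ChannelOmega L h, p z * (stripPull h (hartleySum L S id f) z / h z.1)| ≤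
      N * ((9 / 4) * (1 + M2) * max 4 (max (L / h₀) (h₁ / h₀)) *
        √(stripIntegral L (fun z => hartleySum L S id f z ^ 2) / h₀)) := by
  set D := max 4 (max (L / h₀) (h₁ / h₀)) with hD
  have hD4 : 4 ≤ D := le_max_left _ _
  have hDL : L / h₀ ≤ D := (le_max_left _ _).trans (le_max_right _ _)
  have hDr : h₁ / h₀ ≤ D := (le_max_right _ _).trans (le_max_right _ _)
  have hm : 0 ≤ M2 := (sq_nonneg _).trans (hM1 0)
  obtain ⟨U, V, hU, hV, pU, pV, U0, U1, V0, V1, hdiv, e1, e2, e3, e4⟩ :=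
    exists_strip_field hL hh₀ hD4 hDL S hf hf0
  have hJ : 0 ≤ stripIntegral L (fun z => hartleySum L S id f z ^ 2) :=
    stripIntegral_nonneg hL.le fun _ => sq_nonneg _
  have h1 := abs_pairing_le_of_strip_field hL hh₀ hdiff hlip hperh hlow hhigh hM1 hM2 hp1 hN0 hN
    hU hV pU pV U0 U1 V0 V1
  simp only [hdiv] at h1
  refine h1.trans (mul_le_mul_of_nonneg_left ?_ hN0)
  refine (Real.sqrt_le_sqrt (stripIntegral_stripDensity_le hL.le hh₀ hm hD4 hDr hJ hU hV U1
    e1 e2 e3 e4)).trans (le_of_eq ?_)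
  rw [Real.sqrt_mul (sq_nonneg _), Real.sqrt_sq (by positivity)]

/-- The product of a Hartley basis function with a function of the vertical variable, on the
periodic strip. -/
noncomputable def cylinderHartley (L : ℝ) (n : ℤ) (φ : C(ℝ, ℝ)) :
    C(AddCircle L × Icc (0 : ℝ) 1, ℝ) :=
  ⟨fun w => φ w.2 * ((fourier n w.1 : ℂ).re + (fourier n w.1 : ℂ).im), by fun_prop⟩

theorem cylinderHartley_coe (L : ℝ) (n : ℤ) (φ : C(ℝ, ℝ)) (x : ℝ) (t : Icc (0 : ℝ) 1) :
    cylinderHartley L n φ ((x : AddCircle L), t) = φ t * hartley L n x := by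
  have : 2 * (Real.pi : ℂ) * Complex.I * n * x / L =
      ((waveNumber L n * x : ℝ) : ℂ) * Complex.I := by
    simp only [waveNumber]; push_cast; ring
  simp only [cylinderHartley, ContinuousMap.coe_mk, fourier_coe_apply, this,
    Complex.exp_ofReal_mul_I_re, Complex.exp_ofReal_mul_I_im, hartley]

/-- The span of the functions `cylinderHartley L n φ`. -/
noncomputable def cylinderSpan (L : ℝ) : Submodule ℝ C(AddCircle L × Icc (0 : ℝ) 1, ℝ) :=
  Submodule.span ℝ {E | ∃ n φ, E = cylinderHartley L n φ}

theorem cylinderHartley_mem (L : ℝ) (n : ℤ) (φ : C(ℝ, ℝ)) :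
    cylinderHartley L n φ ∈ cylinderSpan L :=
  Submodule.subset_span ⟨n, φ, rfl⟩

theorem cylinderHartley_mul (L : ℝ) (n m : ℤ) (φ ψ : C(ℝ, ℝ)) :
    cylinderHartley L n φ * cylinderHartley L m ψ = (1 / 2 : ℝ) •
      (cylinderHartley L (n - m) (φ * ψ) + cylinderHartley L (-(n - m)) (φ * ψ) +
        (cylinderHartley L (n + m) (φ * ψ) - cylinderHartley L (-(n + m)) (φ * ψ))) := by
  ext ⟨θ, t⟩
  induction θ using QuotientAddGroup.induction_on with
  | H x =>
    have h1 := cylinderHartley_coe L n φ x t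
    have h2 := cylinderHartley_coe L m ψ x t
    have h3 := fun k => cylinderHartley_coe L k (φ * ψ) x t
    simp only [ContinuousMap.mul_apply, ContinuousMap.smul_apply, ContinuousMap.add_apply,
      ContinuousMap.sub_apply, smul_eq_mul] at h1 h2 h3 ⊢
    rw [h1, h2, h3, h3, h3, h3, mul_mul_mul_comm, hartley_mul_hartley]
    simp only [hartley, waveNumber_neg, neg_mul, Real.cos_neg, Real.sin_neg]
    ring

/-- The algebra of Hartley polynomials on the periodic strip. -/
noncomputable def cylinderAlgebra (L : ℝ) : Subalgebra ℝ C(AddCircle L × Icc (0 : ℝ) 1, ℝ) :=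
  (cylinderSpan L).toSubalgebra
    (by
      have : (1 : C(AddCircle L × Icc (0 : ℝ) 1, ℝ)) = cylinderHartley L 0 1 := by
        ext w
        simp [cylinderHartley]
      rw [this]
      exact cylinderHartley_mem L 0 1)
    (fun x y hx hy => by
      refine Submodule.mul_le.1 ?_ x hx y hy
      rw [cylinderSpan, Submodule.span_mul_span, Submodule.span_le]
      rintro _ ⟨_, ⟨n, φ, rfl⟩, _, ⟨m, ψ, rfl⟩, rfl⟩
      simp only [cylinderHartley_mul]
      exact Submodule.smul_mem _ _ (Submodule.add_mem _
        (Submodule.add_mem _ (cylinderHartley_mem L _ _) (cylinderHartley_mem L _ _))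
        (Submodule.sub_mem _ (cylinderHartley_mem L _ _) (cylinderHartley_mem L _ _))))

theorem cylinderAlgebra_separatesPoints {L : ℝ} (hL : L ≠ 0) :
    (cylinderAlgebra L).SeparatesPoints := by
  rintro ⟨θ, t⟩ ⟨θ', t'⟩ hne
  by_contra! hcon
  have key : ∀ n φ, cylinderHartley L n φ (θ, t) = cylinderHartley L n φ (θ', t') := fun n φ =>
    hcon _ ⟨_, cylinderHartley_mem L n φ, rfl⟩
  refine hne ?_
  induction θ using QuotientAddGroup.induction_on with
  | H x =>
  induction θ' using QuotientAddGroup.induction_on with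
  | H x' =>
  have key' : ∀ n (φ : C(ℝ, ℝ)), φ (t : ℝ) * hartley L n x = φ (t' : ℝ) * hartley L n x' := fun n φ => by
    rw [← cylinderHartley_coe, ← cylinderHartley_coe]
    exact key n φ
  have ht : t = t' := by
    have := key' 0 (ContinuousMap.id ℝ)
    simp only [hartley, waveNumber] at this
    exact Subtype.ext (by simpa using this)
  have h1 := key' 1 1
  have h2 := key' (-1) 1
  simp only [hartley, waveNumber_neg, neg_mul, Real.cos_neg, Real.sin_neg,
    ContinuousMap.one_apply, one_mul] at h1 h2
  obtain ⟨k, hk⟩ := Real.Angle.angle_eq_iff_two_pi_dvd_sub.1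
    (Real.Angle.cos_sin_inj (θ := waveNumber L 1 * x) (ψ := waveNumber L 1 * x') (by linarith)
      (by linarith))
  have hx : x - x' = k * L := by
    have hpi := Real.pi_ne_zero
    simp only [waveNumber] at hk
    push_cast at hk
    field_simp at hk
    linarith
  refine Prod.ext ?_ ht
  refine (QuotientAddGroup.eq_iff_sub_mem.2 ?_)
  rw [hx]
  exact AddSubgroup.mem_zmultiples_iff.2 ⟨k, by simp⟩

theorem exists_hartleySum_of_mem_cylinderSpan {L : ℝ} {G : C(AddCircle L × Icc (0 : ℝ) 1, ℝ)}
    (hG : G ∈ cylinderSpan L) : ∃ (S₀ : Finset ℤ) (f : ℤ → ℝ → ℝ), (∀ n, Continuous (f n)) ∧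
      ∀ S, S₀ ⊆ S → ∀ (x : ℝ) (t : Icc (0 : ℝ) 1),
        G ((x : AddCircle L), t) = hartleySum L S id f (x, t) := by
  induction hG using Submodule.span_induction with
  | mem G hG =>
    obtain ⟨n, φ, rfl⟩ := hG
    refine ⟨{n}, fun m => if m = n then φ else 0, fun m => ?_, fun S hS x t => ?_⟩
    · dsimp only
      split_ifs
      · exact φ.continuous
      · exact continuous_const
    · rw [cylinderHartley_coe, hartleySum, Finset.sum_eq_single n]
      · simp
      · intro m _ hm
        simp [hm]
      · intro hn
        exact absurd (hS (Finset.mem_singleton_self n)) hn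
  | zero => exact ⟨∅, fun _ _ => 0, fun _ => continuous_const, fun S _ x t => by simp [hartleySum]⟩
  | add G G' _ _ hG hG' =>
    obtain ⟨S₀, f, hf, h⟩ := hG
    obtain ⟨S₀', f', hf', h'⟩ := hG'
    refine ⟨S₀ ∪ S₀', fun n z => f n z + f' n z, fun n => (hf n).add (hf' n),
      fun S hS x t => ?_⟩
    rw [ContinuousMap.add_apply, h S (Finset.union_subset_left hS) x t,
      h' S (Finset.union_subset_right hS) x t]
    simp only [hartleySum, ← Finset.sum_add_distrib, add_mul]
  | smul a G _ hG =>
    obtain ⟨S₀, f, hf, h⟩ := hG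
    refine ⟨S₀, fun n z => a * f n z, fun n => (hf n).const_mul a, fun S hS x t => ?_⟩
    rw [ContinuousMap.smul_apply, h S hS x t]
    simp only [hartleySum, smul_eq_mul, Finset.mul_sum, mul_assoc]

theorem exists_hartleySum_near {L : ℝ} (hL : 0 < L) (G : C(AddCircle L × Icc (0 : ℝ) 1, ℝ)) {ε : ℝ}
    (hε : 0 < ε) : ∃ (S : Finset ℤ) (f : ℤ → ℝ → ℝ), 0 ∈ S ∧ (∀ n, Continuous (f n)) ∧
      ∀ (x : ℝ) (t : Icc (0 : ℝ) 1),
        |hartleySum L S id f (x, t) - G ((x : AddCircle L), t)| ≤ ε := by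
  have : Fact (0 < L) := ⟨hL⟩
  obtain ⟨⟨g, hg⟩, hgε⟩ := ContinuousMap.exists_mem_subalgebra_near_continuousMap_of_separatesPoints
    (cylinderAlgebra L) (cylinderAlgebra_separatesPoints hL.ne') G ε hε
  obtain ⟨S, f, hf, h⟩ := exists_hartleySum_of_mem_cylinderSpan hg
  refine ⟨insert 0 S, f, Finset.mem_insert_self _ _, hf, fun x t => ?_⟩
  rw [← h _ (Finset.subset_insert _ _)]
  exact ((g - G).norm_coe_le_norm _).trans hgε.le

/-- The map straightening the channel into the periodic strip. -/
noncomputable def straighten (L : ℝ) (h : ℝ → ℝ) (z : ℝ × ℝ) : AddCircle L × Icc (0 : ℝ) 1 :=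
  ((z.1 : AddCircle L), projIcc 0 1 zero_le_one (z.2 / h z.1))

theorem continuous_straighten (L : ℝ) {h : ℝ → ℝ} (hc : Continuous h) (hpos : ∀ x, 0 < h x) :
    Continuous (straighten L h) := by
  have h1 : Continuous fun z : ℝ × ℝ => z.2 / h z.1 :=
    continuous_snd.div (hc.comp continuous_fst) fun p => (hpos p.1).ne'
  exact ((AddCircle.continuous_mk' L).comp continuous_fst).prodMk (continuous_projIcc.comp h1)

theorem straighten_snd {L : ℝ} {h : ℝ → ℝ} (hpos : ∀ x, 0 < h x) {z : ℝ × ℝ}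
    (hz : z ∈ ChannelOmega L h) : ((straighten L h z).2 : ℝ) = z.2 / h z.1 := by
  rw [straighten, projIcc_of_mem zero_le_one
    ⟨div_nonneg hz.2.1.le (hpos _).le, (div_le_one (hpos _)).2 hz.2.2.le⟩]

theorem exists_measurable_comp_straighten {L : ℝ} (hL : 0 < L) {h : ℝ → ℝ} (hc : Continuous h)
    (hpos : ∀ x, 0 < h x) {g : ℝ × ℝ → ℝ} (hg : Measurable g) :
    ∃ q : AddCircle L × Icc (0 : ℝ) 1 → ℝ, Measurable q ∧
      ∀ z ∈ ChannelOmega L h, q (straighten L h z) = g z := by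
  have : Fact (0 < L) := ⟨hL⟩
  refine ⟨fun w => g ((AddCircle.measurableEquivIoc L 0 w.1 : ℝ),
    w.2 * h (AddCircle.measurableEquivIoc L 0 w.1 : ℝ)), ?_, fun z hz => ?_⟩
  · have h1 : Measurable fun w : AddCircle L × Icc (0 : ℝ) 1 =>
        (AddCircle.measurableEquivIoc L 0 w.1 : ℝ) :=
      measurable_subtype_coe.comp ((AddCircle.measurableEquivIoc L 0).measurable.comp measurable_fst)
    exact hg.comp (h1.prodMk
      ((measurable_subtype_coe.comp measurable_snd).mul (hc.measurable.comp h1)))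
  · have h1 : (AddCircle.measurableEquivIoc L 0 (straighten L h z).1 : ℝ) = z.1 := by
      have hz1 : z.1 ∈ Ioc 0 (0 + L) := ⟨hz.1.1, by simpa using hz.1.2.le⟩
      exact congrArg Subtype.val ((AddCircle.equivIoc L 0).apply_symm_apply ⟨z.1, hz1⟩)
    simp only [h1, div_mul_cancel₀ _ (hpos z.1).ne', straighten_snd hpos hz]

/-- Hartley polynomials are dense in `L²` of the channel. -/
theorem exists_eLpNorm_hartleySum_sub_le {L : ℝ} (hL : 0 < L) {h : ℝ → ℝ} {h₁ : ℝ}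
    (hc : Continuous h) (hpos : ∀ x, 0 < h x) (hhigh : ∀ x, h x ≤ h₁) {g : ℝ × ℝ → ℝ}
    (hg : MemLp g 2 (volume.restrict (ChannelOmega L h))) {ε : ENNReal} (hε : ε ≠ 0) :
    ∃ (S : Finset ℤ) (f : ℤ → ℝ → ℝ), 0 ∈ S ∧ (∀ n, Continuous (f n)) ∧
      eLpNorm (g - stripPull h (hartleySum L S id f)) 2 (volume.restrict (ChannelOmega L h)) ≤ ε := by
  have : Fact (0 < L) := ⟨hL⟩
  set μ := volume.restrict (ChannelOmega L h) with hμ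
  have : IsFiniteMeasure μ := ⟨by
    have := (integrableOn_channelOmega L hhigh (continuous_const (y := (1 : ℝ))))
    rw [integrableOn_const_iff] at this
    simpa [hμ] using this⟩
  have hΩ := measurableSet_channelOmega L hc
  have hΨ := continuous_straighten L hc hpos
  obtain ⟨q, hqm, hq⟩ := exists_measurable_comp_straighten hL hc hpos
    hg.1.stronglyMeasurable_mk.measurable
  have hqg : q ∘ straighten L h =ᵐ[μ] g := by
    filter_upwards [ae_restrict_mem hΩ, hg.1.ae_eq_mk] with z hz hz'
    rw [Function.comp_apply, hq z hz, hz']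
  have hqL : MemLp q 2 (μ.map (straighten L h)) := by
    rw [memLp_map_measure_iff hqm.aestronglyMeasurable hΨ.measurable.aemeasurable]
    exact (memLp_congr_ae hqg).2 hg
  obtain ⟨G, hG, -⟩ := hqL.exists_boundedContinuous_eLpNorm_sub_le (by simp)
    (ENNReal.half_pos hε).ne'
  rw [eLpNorm_map_measure (hqL.1.sub G.continuous.aestronglyMeasurable)
    hΨ.measurable.aemeasurable] at hG
  obtain ⟨η, hη, hηε⟩ : ∃ η : NNReal, 0 < η ∧ eLpNorm (fun _ => (η : ℝ)) 2 μ ≤ ε / 2 := by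
    obtain ⟨η, hη, hle⟩ := ENNReal.exists_nnreal_pos_mul_lt
      (a := μ univ ^ (1 / (2 : ENNReal).toReal)) (by finiteness) (ENNReal.half_pos hε).ne'
    refine ⟨η, hη, (eLpNorm_const' _ two_ne_zero ENNReal.ofNat_ne_top).trans_le ?_⟩
    simpa using hle.le
  obtain ⟨S, f, hS, hf, hnear⟩ := exists_hartleySum_near hL G.toContinuousMap hη
  refine ⟨S, f, hS, hf, ?_⟩
  have cF := continuous_stripPull hc hpos (continuous_hartleySum L S id hf)
  have e1 : eLpNorm (G ∘ straighten L h - stripPull h (hartleySum L S id f)) 2 μ ≤ ε / 2 := by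
    refine le_trans (eLpNorm_mono_ae ?_) hηε
    filter_upwards [ae_restrict_mem hΩ] with z hz
    have h1 := hnear z.1 (straighten L h z).2
    rw [straighten_snd hpos hz, abs_sub_comm] at h1
    have h2 : |G (straighten L h z) - stripPull h (hartleySum L S id f) z| ≤ η := h1
    simpa using h2
  have e2 : eLpNorm (g - G ∘ straighten L h) 2 μ ≤ ε / 2 := by
    refine le_trans (le_of_eq (eLpNorm_congr_ae ?_)) hG
    filter_upwards [hqg] with z hz
    simp [← hz]
  have hsplit : g - stripPull h (hartleySum L S id f) = (g - G ∘ straighten L h) +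
      (G ∘ straighten L h - stripPull h (hartleySum L S id f)) := by ring
  rw [hsplit, ← ENNReal.add_halves ε]
  exact (eLpNorm_add_le (hg.1.sub (G.continuous.comp hΨ).aestronglyMeasurable)
    ((G.continuous.comp hΨ).sub cF).aestronglyMeasurable (by norm_num)).trans (add_le_add e2 e1)

theorem inner_toLp_eq_integral {α : Type*} [MeasurableSpace α] {μ : Measure α} {f g : α → ℝ}
    (hf : MemLp f 2 μ) (hg : MemLp g 2 μ) :
    inner ℝ (hf.toLp f) (hg.toLp g) = ∫ x, f x * g x ∂μ := by
  rw [L2.inner_def]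
  refine integral_congr_ae ?_
  filter_upwards [hf.coeFn_toLp, hg.coeFn_toLp] with x h1 h2
  rw [h1, h2]
  simp [mul_comm]

theorem norm_toLp_sq_eq_integral {α : Type*} [MeasurableSpace α] {μ : Measure α} {f : α → ℝ}
    (hf : MemLp f 2 μ) : ‖hf.toLp f‖ ^ 2 = ∫ x, f x ^ 2 ∂μ := by
  rw [← real_inner_self_eq_norm_sq, inner_toLp_eq_integral]
  simp only [sq]

theorem abs_integral_mul_le_norm_toLp {α : Type*} [MeasurableSpace α] {μ : Measure α}
    {f g : α → ℝ} (hf : MemLp f 2 μ) (hg : MemLp g 2 μ) :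
    |∫ x, f x * g x ∂μ| ≤ ‖hf.toLp f‖ * ‖hg.toLp g‖ := by
  rw [← inner_toLp_eq_integral hf hg]
  exact abs_real_inner_le_norm _ _

theorem hartleySum_sub_const (L : ℝ) {S : Finset ℤ} (hS : 0 ∈ S) (f : ℤ → ℝ → ℝ) (c : ℝ)
    (p : ℝ × ℝ) : hartleySum L S id (fun n z => f n z - if n = 0 then c else 0) p =
      hartleySum L S id f p - c := by
  simp [hartleySum, sub_mul, Finset.sum_sub_distrib, hS, hartley, waveNumber]

theorem stripIntegral_sub_const_sq_le {L : ℝ} (hL : 0 ≤ L) {F : ℝ × ℝ → ℝ} (hF : Continuous F)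
    {c : ℝ} (hc : stripIntegral L F = L * c) :
    stripIntegral L (fun p => (F p - c) ^ 2) ≤ stripIntegral L (fun p => F p ^ 2) := by
  have h1 : stripIntegral L (fun p => (F p - c) ^ 2) =
      stripIntegral L (fun p => F p ^ 2) + (-2 * c * stripIntegral L F + c ^ 2 * L) := by
    rw [← stripIntegral_const_mul,
      show c ^ 2 * L = stripIntegral L (fun _ => c ^ 2) by simp [stripIntegral, mul_comm],
      ← stripIntegral_add L (by fun_prop) (by fun_prop),
      ← stripIntegral_add L (by fun_prop) (by fun_prop)]
    congr 1
    ext p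
    ring
  rw [h1, hc]
  nlinarith [mul_nonneg hL (sq_nonneg c)]

/-- The pairing of a mean-zero pressure with a Hartley polynomial `F` close to `h p`. -/
theorem integral_sq_le_of_approx {L h₀ h₁ C N : ℝ} (hL : 0 < L) (hh₀ : 0 < h₀) {h : ℝ → ℝ}
    (hc : Continuous h) (hlow : ∀ x, h₀ ≤ h x) (hhigh : ∀ x, h x ≤ h₁) {p : ℝ × ℝ → ℝ}
    (hp : MemLp p 2 (volume.restrict (ChannelOmega L h)))
    (hp1 : IntegrableOn p (ChannelOmega L h)) (hmean : ∫ z in ChannelOmega L h, p z = 0)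
    (hNC : 0 ≤ N * C)
    (hpair : ∀ (S : Finset ℤ) (f : ℤ → ℝ → ℝ), (∀ n, Continuous (f n)) →
      ∫ z in (0 : ℝ)..1, f 0 z = 0 →
      |∫ z in ChannelOmega L h, p z * (stripPull h (hartleySum L S id f) z / h z.1)| ≤
        N * (C * √(stripIntegral L (fun z => hartleySum L S id f z ^ 2) / h₀))) :
    ∃ A : ℝ, ∀ ε : ℝ, 0 < ε → ∫ z in ChannelOmega L h, p z ^ 2 ≤
      A * ε + N * (C * √((h₁ * (∫ z in ChannelOmega L h, p z ^ 2) +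
        2 * √(∫ z in ChannelOmega L h, p z ^ 2) * ε + ε ^ 2 / h₀) / h₀)) := by
  have hpos : ∀ x, 0 < h x := fun x => hh₀.trans_le (hlow x)
  have hne : ∀ x, h x ≠ 0 := fun x => (hpos x).ne'
  have hΩ := measurableSet_channelOmega L hc
  set μ := volume.restrict (ChannelOmega L h) with hμ
  have memC : ∀ {G : ℝ × ℝ → ℝ}, Continuous G → MemLp G 2 μ := fun {G} hG =>
    (memLp_two_iff_integrable_sq hG.aestronglyMeasurable).2
      (integrableOn_channelOmega L hhigh (hG.pow 2))
  have memM : ∀ {G : ℝ × ℝ → ℝ}, Continuous G → ∀ {q : ℝ × ℝ → ℝ}, MemLp q 2 μ →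
      MemLp (fun z => q z * G z) 2 μ := by
    intro G hG q hq
    obtain ⟨B, hB⟩ := (isCompact_Icc.prod isCompact_Icc).exists_bound_of_continuousOn
      (s := Icc 0 L ×ˢ Icc 0 h₁) hG.continuousOn
    refine hq.of_le_mul (c := B) (hq.1.mul hG.aestronglyMeasurable) ?_
    filter_upwards [ae_restrict_mem hΩ] with z hz
    rw [norm_mul, mul_comm]
    exact mul_le_mul_of_nonneg_right (hB z (channelOmega_subset L hhigh hz)) (norm_nonneg _)
  have ci : Continuous fun z : ℝ × ℝ => (h z.1)⁻¹ := by fun_prop (disch := simp [hne])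
  have hph := memM ci hp
  have hhp : MemLp (fun z => p z * h z.1) 2 μ := memM (hc.comp continuous_fst) hp
  have h1h := memC ci
  set I := ∫ z in ChannelOmega L h, p z ^ 2 with hI
  have hP : ‖hp.toLp p‖ = √I := by
    rw [hI, ← norm_toLp_sq_eq_integral hp, Real.sqrt_sq (norm_nonneg _)]
  refine ⟨‖hph.toLp _‖ + ‖h1h.toLp _‖ / L * |∫ z in ChannelOmega L h, p z * (h z.1)⁻¹|,
    fun ε hε => ?_⟩
  obtain ⟨S, f, hS, hf, hle⟩ := exists_eLpNorm_hartleySum_sub_le hL hc hpos hhigh hhp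
    (ENNReal.ofReal_pos.2 hε).ne'
  set F := hartleySum L S id f with hF
  have cF : Continuous F := continuous_hartleySum L S id hf
  have cFs := continuous_stripPull hc hpos cF
  have he := hhp.sub (memC cFs)
  set e : ℝ × ℝ → ℝ := (fun z => p z * h z.1) - stripPull h F with hedef
  have hee : ∀ z, stripPull h F z = p z * h z.1 - e z := fun z => by simp [hedef]
  have hεe : ‖he.toLp e‖ ≤ ε := by
    rw [Lp.norm_toLp]
    exact ENNReal.toReal_le_of_le_ofReal hε.le hle
  have int : ∀ {a b : ℝ × ℝ → ℝ}, MemLp a 2 μ → MemLp b 2 μ → Integrable (fun z => a z * b z) μ :=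
    fun ha hb => ha.integrable_mul hb
  set c := ∫ z in (0 : ℝ)..1, f 0 z with hcdef
  have hFc : stripIntegral L F = L * c := integral_hartleySum hL.ne' S hf hS
  have hce : L * c = -∫ z, (h z.1)⁻¹ * e z ∂μ := by
    rw [← hFc, stripIntegral, ← setIntegral_stripPull_div hL.le hc hpos hhigh cF, ← zero_sub, ← hmean,
      ← integral_sub hp1 (int h1h he)]
    refine integral_congr_ae (Filter.Eventually.of_forall fun z => ?_)
    have := hne z.1
    simp only [hee]
    field_simp
  have hJ : stripIntegral L (fun z => F z ^ 2) ≤ h₁ * I + 2 * √I * ε + ε ^ 2 / h₀ := by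
    have hpe := abs_integral_mul_le_norm_toLp hp he
    have h1 : stripIntegral L (fun z => F z ^ 2) =
        (∫ z, p z * (p z * h z.1) ∂μ) + (-2 * ∫ z, p z * e z ∂μ) +
          ∫ z, e z * (e z * (h z.1)⁻¹) ∂μ := by
      have cF2 : Continuous fun z => F z ^ 2 := cF.pow 2
      have i1 : Integrable (fun z => p z * (p z * h z.1) + -2 * (p z * e z)) μ :=
        (int hp hhp).add ((int hp he).const_mul _)
      rw [stripIntegral, ← setIntegral_stripPull_div hL.le hc hpos hhigh cF2,
        ← integral_const_mul, ← integral_add (int hp hhp) ((int hp he).const_mul _),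
        ← integral_add i1 (int he (memM ci he))]
      refine integral_congr_ae (Filter.Eventually.of_forall fun z => ?_)
      have h2 : stripPull h (fun z => F z ^ 2) z = stripPull h F z ^ 2 := rfl
      have := hne z.1
      simp only [h2, hee]
      field_simp
      ring
    have h2 : ∫ z, p z * (p z * h z.1) ∂μ ≤ h₁ * I := by
      rw [hI, ← integral_const_mul]
      refine integral_mono (int hp hhp) (((memLp_two_iff_integrable_sq hp.1).1 hp).const_mul _)
        fun z => ?_
      simp only
      nlinarith [mul_le_mul_of_nonneg_right (hhigh z.1) (sq_nonneg (p z))]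
    have h3 : ∫ z, e z * (e z * (h z.1)⁻¹) ∂μ ≤ ε ^ 2 / h₀ := by
      calc ∫ z, e z * (e z * (h z.1)⁻¹) ∂μ ≤ ∫ z, h₀⁻¹ * e z ^ 2 ∂μ := by
            refine integral_mono (int he (memM ci he))
              (((memLp_two_iff_integrable_sq he.1).1 he).const_mul _) fun z => ?_
            simp only
            nlinarith [mul_le_mul_of_nonneg_right (inv_anti₀ hh₀ (hlow z.1)) (sq_nonneg (e z))]
        _ = h₀⁻¹ * ‖he.toLp e‖ ^ 2 := by rw [integral_const_mul, norm_toLp_sq_eq_integral]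
        _ ≤ h₀⁻¹ * ε ^ 2 := by gcongr
        _ = ε ^ 2 / h₀ := by ring
    have h4 : ‖hp.toLp p‖ * ‖he.toLp e‖ ≤ √I * ε := by rw [hP]; gcongr
    have h5 := (abs_le.1 hpe).1
    rw [h1]
    linarith
  have hmain := hpair S (fun n z => f n z - if n = 0 then c else 0)
    (fun n => (hf n).sub continuous_const) (by
      simp only [if_true]
      rw [intervalIntegral.integral_sub ((hf 0).intervalIntegrable _ _)
        intervalIntegrable_const]
      simp [hcdef])
  have hmain' : |∫ z in ChannelOmega L h,
      p z * (stripPull h (hartleySum L S id fun n z => f n z - if n = 0 then c else 0) z / h z.1)| ≤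
      N * (C * √((h₁ * I + 2 * √I * ε + ε ^ 2 / h₀) / h₀)) := by
    refine hmain.trans ?_
    rw [← mul_assoc, ← mul_assoc]
    refine mul_le_mul_of_nonneg_left (Real.sqrt_le_sqrt ?_) hNC
    gcongr
    refine le_trans ?_ hJ
    simp only [hartleySum_sub_const L hS]
    exact stripIntegral_sub_const_sq_le hL.le cF hFc
  have hdecomp : ∫ z in ChannelOmega L h, p z *
      (stripPull h (hartleySum L S id fun n z => f n z - if n = 0 then c else 0) z / h z.1) =
      I - (∫ z, p z * (h z.1)⁻¹ * e z ∂μ) - c * ∫ z, p z * (h z.1)⁻¹ ∂μ := by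
    have i0 := (memLp_two_iff_integrable_sq hp.1).1 hp
    have i1 : Integrable (fun z => p z ^ 2 - p z * (h z.1)⁻¹ * e z) μ := i0.sub (int hph he)
    rw [hI, ← integral_const_mul, ← integral_sub i0 (int hph he),
      ← integral_sub i1 ((int hp h1h).const_mul c)]
    refine integral_congr_ae (Filter.Eventually.of_forall fun z => ?_)
    have h2 : stripPull h (hartleySum L S id fun n z => f n z - if n = 0 then c else 0) z =
      stripPull h F z - c := hartleySum_sub_const L hS f c _
    have := hne z.1
    simp only [h2, hee]
    field_simp
  have b1 : |∫ z, p z * (h z.1)⁻¹ * e z ∂μ| ≤ ‖hph.toLp _‖ * ε :=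
    (abs_integral_mul_le_norm_toLp hph he).trans (by gcongr)
  have b2 : |c| ≤ ‖h1h.toLp _‖ / L * ε := by
    have h3 : L * |c| ≤ ‖h1h.toLp _‖ * ε := by
      rw [← abs_of_pos hL, ← abs_mul, hce, abs_neg]
      exact (abs_integral_mul_le_norm_toLp h1h he).trans (by gcongr)
    rw [div_mul_eq_mul_div, le_div_iff₀ hL]
    linarith
  have b3 : |c * ∫ z, p z * (h z.1)⁻¹ ∂μ| ≤
      ‖h1h.toLp _‖ / L * ε * |∫ z, p z * (h z.1)⁻¹ ∂μ| := by
    rw [abs_mul]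
    gcongr
  rw [hdecomp] at hmain'
  have := (abs_le.1 hmain').2
  have := (abs_le.1 b1).2
  have := (abs_le.1 b3).2
  linarith

/-- Theorem 4.1 (inf-sup estimate, `C^{1,1}` boundary): for `h ∈ C^{1,1}(T)`
with `0 < h₀ ≤ h ≤ h₁` and
`M² ≥ max(‖h_x‖²_∞, ‖(1/2) h h_{xx}‖_∞)`, every mean-zero `p ∈ L²(Ω)`
satisfies `‖p‖₀ ≤ β⁻¹ ‖∇p‖₋₁` with
`β⁻¹ = (9/4)(1+M²)(h₁/h₀)^{1/2} max(4, L/h₀, h₁/h₀)`.  The dual norm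
`‖∇p‖₋₁` is encoded by a bound `N` on the distributional pairing
`⟨∇p, (u,v)⟩ = −∫ p (∂ₓu + ∂_y v)` over all vector test functions. -/
theorem infsup_channel_C11 (L h₀ h₁ M2 : ℝ) (hL : 0 < L) (hh₀ : 0 < h₀)
    (h : ℝ → ℝ) (hdiff : Differentiable ℝ h) (K : NNReal)
    (hlip : LipschitzWith K (deriv h))
    (hperh : ∀ x, h (x + L) = h x)
    (hlow : ∀ x, h₀ ≤ h x) (hhigh : ∀ x, h x ≤ h₁)
    (hM1 : ∀ x, (deriv h x) ^ 2 ≤ M2)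
    (hM2 : ∀ x, |(1 / 2) * h x * deriv (deriv h) x| ≤ M2)
    (p : ℝ × ℝ → ℝ)
    (hp2 : MeasureTheory.IntegrableOn (fun z => (p z) ^ 2) (ChannelOmega L h))
    (hp1 : MeasureTheory.IntegrableOn p (ChannelOmega L h))
    (hmean : ∫ z in ChannelOmega L h, p z = 0)
    (N : ℝ)
    (hN : ∀ u v : ℝ × ℝ → ℝ, AdmChannel L h u → AdmChannel L h v →
      |∫ z in ChannelOmega L h,
          p z * ((fderiv ℝ u z (1, 0)) + (fderiv ℝ v z (0, 1)))|
        ≤ N * Real.sqrt (energyChannel L h u + energyChannel L h v)) :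
    Real.sqrt (∫ z in ChannelOmega L h, (p z) ^ 2)
      ≤ ((9 / 4) * (1 + M2) * Real.sqrt (h₁ / h₀) *
          max 4 (max (L / h₀) (h₁ / h₀))) * N := by
  have hpos : ∀ x, 0 < h x := fun x => hh₀.trans_le (hlow x)
  have hc1 : ContDiff ℝ 1 h := contDiff_one_of_lipschitz_deriv hdiff hlip
  have hN0 : 0 ≤ N := nonneg_of_energy_bound hL hc1 hperh hpos hhigh fun u v hu hv =>
    (abs_nonneg _).trans (hN u v hu hv)
  have hm : 0 ≤ M2 := (sq_nonneg _).trans (hM1 0)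
  set C := (9 / 4) * (1 + M2) * max 4 (max (L / h₀) (h₁ / h₀)) with hC
  have hC0 : 0 ≤ C := by positivity
  have hp : MemLp p 2 (volume.restrict (ChannelOmega L h)) :=
    (memLp_two_iff_integrable_sq hp1.1).2 hp2
  obtain ⟨A, hA⟩ := integral_sq_le_of_approx hL hh₀ hc1.continuous hlow hhigh hp hp1 hmean
    (mul_nonneg hN0 hC0) fun S f hf hf0 =>
      abs_pairing_hartleySum_le hL hh₀ hdiff hlip hperh hlow hhigh hM1 hM2 hp1 hN0 hN S hf hf0
  set I := ∫ z in ChannelOmega L h, p z ^ 2 with hI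
  have hI0 : 0 ≤ I := integral_nonneg fun _ => sq_nonneg _
  have hlim : Filter.Tendsto (fun ε => A * ε + N * (C * √((h₁ * I + 2 * √I * ε + ε ^ 2 / h₀) / h₀)))
      (nhdsWithin 0 (Ioi 0)) (nhds (N * (C * √(h₁ * I / h₀)))) := by
    have hcont : Continuous fun ε : ℝ =>
        A * ε + N * (C * √((h₁ * I + 2 * √I * ε + ε ^ 2 / h₀) / h₀)) := by fun_prop
    simpa using (hcont.tendsto 0).mono_left nhdsWithin_le_nhds
  have hle : I ≤ N * (C * √(h₁ * I / h₀)) :=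
    ge_of_tendsto hlim (eventually_mem_nhdsWithin.mono fun ε hε => hA ε hε)
  have hr : 0 ≤ h₁ / h₀ := div_nonneg (hh₀.le.trans ((hlow 0).trans (hhigh 0))) hh₀.le
  rw [mul_div_right_comm, Real.sqrt_mul hr] at hle
  have hgoal : √I ≤ C * √(h₁ / h₀) * N := by
    rcases hI0.eq_or_lt with h0 | h0
    · rw [← h0, Real.sqrt_zero]
      positivity
    · refine le_of_mul_le_mul_right ?_ (Real.sqrt_pos.2 h0)
      rw [Real.mul_self_sqrt hI0]
      linarith
  refine hgoal.trans (le_of_eq ?_)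
  rw [hC]
  ring
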